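/- arXiv:2103.13448 — 2 statements merged into one kernel-verified Lean document; each statement's English description precedes it below -/
import Mathlib

section
/- Let (λ_j)_{j≥1} be a sequence interlacing with 𝒩 (i.e. n_{j-1} < λ_j < n_j for all j ≥ 1) such that the averaged distances satisfy (1/#{k : λ_k ≤ x}) · Σ_{λ_k ≤ x} Δ_k = O((log x)^{−1/2}) as x → ∞ (weak coupling quantization). Then there exists a full density set of indices J ⊆ ℕ such that for every q ≥ 1 one has lim_{j∈J, j→∞} log m_q(λ_j) / ((½ log 2) · log log ñ_j) = 1; consequently, for every q > 1, lim_{j∈J, j→∞} (log m_q(λ_j) − q·log m_1(λ_j)) / ((1−q)·(½ log 2)·log log ñ_j) = 1. (That is, the fractal exponents satisfy d_q = D_q = 1 with respect to the scaling parameter N = (log ñ_j)^{(1/2)log 2}.) -/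
open Filter Topology

noncomputable section

/-- The set of natural numbers expressible as a sum of two squares. -/
def SOS : Set ℕ := {n | ∃ x y : ℤ, (n : ℤ) = x ^ 2 + y ^ 2}

/-- `r₂(n)`, the number of representations of `n` as a sum of two squares. -/
def r2 (n : ℕ) : ℕ := Nat.card {p : ℤ × ℤ // p.1 ^ 2 + p.2 ^ 2 = (n : ℤ)}

/-- A set `J` of indices has full density if `#(J ∩ [1,k])/k → 1`. -/
def FullDensityIdx (J : Set ℕ) : Prop :=
  Tendsto (fun k : ℕ => (Nat.card ↥(J ∩ Set.Icc 1 k) : ℝ) / (k : ℝ)) atTop (𝓝 1)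

/-- The moment `m_q(λ) = Δ^{2q} ∑_{n ∈ 𝒩} r₂(n) |n − λ|^{−2q}`
(the summand vanishes for `n ∉ 𝒩` since then `r₂(n) = 0`). -/
def mq (q lam Δ : ℝ) : ℝ :=
  Δ ^ (2 * q) * ∑' n : ℕ, (r2 n : ℝ) * |(n : ℝ) - lam| ^ (-(2 * q))

/-- The average `⟨Δ⟩_x = (1/#{k : λ_k ≤ x}) ∑_{λ_k ≤ x} Δ_k` (indices `k ≥ 1`). -/
def avgD (lam D : ℕ → ℝ) (x : ℝ) : ℝ :=
  (∑' k : {k : ℕ // 1 ≤ k ∧ lam k ≤ x}, D (k : ℕ)) /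
    (Nat.card {k : ℕ // 1 ≤ k ∧ lam k ≤ x} : ℝ)

section Mertens

open Finset ArithmeticFunction

/-- The Dirichlet test with an explicit bound. -/
theorem abs_sum_mul_le_of_antitone {c g : ℕ → ℝ} {C : ℝ} {a : ℕ}
    (hc : ∀ k, |∑ n ∈ Ico a (a + k), c n| ≤ C) (hg : ∀ n, a ≤ n → 0 ≤ g n)
    (hanti : ∀ n, a ≤ n → g (n + 1) ≤ g n) (k : ℕ) :
    |∑ n ∈ Ico a (a + k), c n * g n| ≤ C * g a := by
  have key : ∀ k, |∑ n ∈ Ico a (a + k), c n * g n - (∑ n ∈ Ico a (a + k), c n) * g (a + k)|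
      ≤ C * (g a - g (a + k)) := by
    intro k
    induction k with
    | zero => simp
    | succ k ih =>
      have h1 := hanti (a + k) (by omega)
      have h2 : |(∑ n ∈ Ico a (a + (k + 1)), c n) * (g (a + k) - g (a + k + 1))|
          ≤ C * (g (a + k) - g (a + k + 1)) := by
        rw [abs_mul, abs_of_nonneg (sub_nonneg.2 h1)]
        exact mul_le_mul_of_nonneg_right (hc _) (sub_nonneg.2 h1)
      have h3 := abs_add_le
        (∑ n ∈ Ico a (a + k), c n * g n - (∑ n ∈ Ico a (a + k), c n) * g (a + k))
        ((∑ n ∈ Ico a (a + (k + 1)), c n) * (g (a + k) - g (a + k + 1)))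
      rw [show a + (k + 1) = a + k + 1 from rfl] at *
      rw [sum_Ico_succ_top (by omega)] at *
      rw [sum_Ico_succ_top (by omega)]
      calc _ = _ := by congr 1; ring
        _ ≤ _ := h3
        _ ≤ _ := by linarith
  have h1 := key k
  have h2 : |(∑ n ∈ Ico a (a + k), c n) * g (a + k)| ≤ C * g (a + k) := by
    rw [abs_mul, abs_of_nonneg (hg _ (by omega))]
    exact mul_le_mul_of_nonneg_right (hc _) (hg _ (by omega))
  have h3 := abs_add_le
    (∑ n ∈ Ico a (a + k), c n * g n - (∑ n ∈ Ico a (a + k), c n) * g (a + k))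
    ((∑ n ∈ Ico a (a + k), c n) * g (a + k))
  rw [sub_add_cancel] at h3
  linarith

theorem log_factorial_bounds (N : ℕ) (hN : 1 ≤ N) :
    N * Real.log N - N ≤ ∑ n ∈ Ioc 0 N, Real.log n ∧
      ∑ n ∈ Ioc 0 N, Real.log n ≤ N * Real.log N := by
  constructor
  · induction N, hN using Nat.le_induction with
    | base => simp
    | succ n hn ih =>
      rw [sum_Ioc_succ_top (by omega)]
      have hn' : (0 : ℝ) < n := by exact_mod_cast hn
      have h := Real.log_le_sub_one_of_pos (x := (n + 1 : ℝ) / n) (by positivity)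
      rw [Real.log_div (by positivity) (by positivity)] at h
      have h2 : (n : ℝ) * (Real.log (n + 1) - Real.log n) ≤ 1 := by
        calc _ ≤ (n : ℝ) * ((n + 1) / n - 1) := by gcongr
          _ = 1 := by field_simp; ring
      push_cast [Nat.succ_eq_add_one] at *
      linarith
  · calc _ ≤ ∑ n ∈ Ioc 0 N, Real.log N := by
          apply sum_le_sum
          intro n hn
          rw [mem_Ioc] at hn
          apply Real.log_le_log
          · exact_mod_cast hn.1
          · exact_mod_cast hn.2
      _ = _ := by simp

theorem sum_vonMangoldt_le (N : ℕ) : ∑ n ∈ Ioc 0 N, Λ n ≤ (Real.log 4 + 4) * N := by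
  have := Chebyshev.psi_le_const_mul_self (x := N) (by positivity)
  simpa [Chebyshev.psi] using this

/-- The first Mertens theorem for the von Mangoldt function. -/
theorem abs_sum_vonMangoldt_div_sub_log_le (N : ℕ) (hN : 1 ≤ N) :
    |∑ n ∈ Ioc 0 N, Λ n / n - Real.log N| ≤ Real.log 4 + 4 := by
  have h1 : ∑ n ∈ Ioc 0 N, Real.log n = ∑ n ∈ Ioc 0 N, Λ n * (N / n : ℕ) := by
    rw [← sum_Ioc_mul_zeta_eq_sum]
    apply sum_congr rfl
    intro n _
    rw [vonMangoldt_mul_zeta, log_apply]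
  have hN' : (0 : ℝ) < N := by exact_mod_cast hN
  obtain ⟨h2, h3⟩ := log_factorial_bounds N hN
  have h4 : ∑ n ∈ Ioc 0 N, Λ n * (N / n : ℕ) ≤ N * ∑ n ∈ Ioc 0 N, Λ n / n := by
    rw [mul_sum]
    apply sum_le_sum
    intro n hn
    calc Λ n * (N / n : ℕ) ≤ Λ n * (N / n : ℝ) :=
          mul_le_mul_of_nonneg_left Nat.cast_div_le vonMangoldt_nonneg
      _ = _ := by ring
  have h5 : N * ∑ n ∈ Ioc 0 N, Λ n / n ≤
      ∑ n ∈ Ioc 0 N, Λ n * (N / n : ℕ) + ∑ n ∈ Ioc 0 N, Λ n := by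
    rw [mul_sum, ← sum_add_distrib]
    apply sum_le_sum
    intro n hn
    rw [mem_Ioc] at hn
    have hn' : (0 : ℝ) < n := by exact_mod_cast hn.1
    have : (N / n : ℝ) ≤ (N / n : ℕ) + 1 := by
      rw [div_le_iff₀ hn']
      have := (Nat.lt_div_mul_add hn.1 (a := N)).le
      have h : N ≤ (N / n + 1) * n := by linarith
      exact_mod_cast h
    calc N * (Λ n / n) = Λ n * (N / n : ℝ) := by ring
      _ ≤ Λ n * ((N / n : ℕ) + 1) := mul_le_mul_of_nonneg_left this vonMangoldt_nonneg
      _ = _ := by ring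
  have h6 := sum_vonMangoldt_le N
  have hl : 0 ≤ Real.log 4 := Real.log_nonneg (by norm_num)
  set S := ∑ n ∈ Ioc 0 N, Λ n / n
  rw [abs_le]
  constructor
  · have : N * (Real.log N - 1) ≤ N * S := by linarith
    have := le_of_mul_le_mul_left this hN'
    linarith
  · have : N * S ≤ N * (Real.log N + (Real.log 4 + 4)) := by linarith
    have := le_of_mul_le_mul_left this hN'
    linarith

/-- The nontrivial Dirichlet character modulo four, with real values. -/
def chiFour (n : ℕ) : ℝ := (ZMod.χ₄ n : ℤ)

theorem chiFour_mul (m n : ℕ) : chiFour (m * n) = chiFour m * chiFour n := by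
  rw [chiFour, Nat.cast_mul, map_mul, Int.cast_mul]
  rfl

theorem chiFour_eq (n : ℕ) :
    chiFour n = if n % 2 = 0 then 0 else if n % 4 = 1 then 1 else -1 := by
  rw [chiFour, ZMod.χ₄_nat_eq_if_mod_four]
  push_cast
  split_ifs <;> simp

theorem abs_chiFour_le (n : ℕ) : |chiFour n| ≤ 1 := by
  rw [chiFour_eq]; split_ifs <;> simp

theorem abs_sum_chiFour_le (a k : ℕ) : |∑ n ∈ Ico a (a + k), chiFour n| ≤ 1 := by
  have key : ∀ k, ∑ n ∈ Ico a (a + k), chiFour n =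
      (if (a + k) % 4 = 2 ∨ (a + k) % 4 = 3 then 1 else 0) -
        (if a % 4 = 2 ∨ a % 4 = 3 then 1 else 0) := by
    intro k
    induction k with
    | zero => simp
    | succ k ih =>
      rw [show a + (k + 1) = a + k + 1 from rfl, sum_Ico_succ_top (by omega), ih, chiFour_eq]
      have : (a + k) % 4 < 4 := Nat.mod_lt _ (by norm_num)
      rcases (by omega : (a + k) % 4 = 0 ∨ (a + k) % 4 = 1 ∨ (a + k) % 4 = 2 ∨ (a + k) % 4 = 3)
        with h | h | h | h
      · simp [h, show (a + k + 1) % 4 = 1 by omega, show (a + k) % 2 = 0 by omega]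
      · simp [h, show (a + k + 1) % 4 = 2 by omega, show (a + k) % 2 = 1 by omega]
        ring
      · simp [h, show (a + k + 1) % 4 = 3 by omega, show (a + k) % 2 = 0 by omega]
      · simp [h, show (a + k + 1) % 4 = 0 by omega, show (a + k) % 2 = 1 by omega]
        ring
  rw [key]
  split_ifs <;> simp

theorem abs_sum_chiFour_div_le (a b : ℕ) :
    |∑ n ∈ Ioc a b, chiFour n / n| ≤ 1 / (a + 1) := by
  rcases le_total b a with h | h
  · rw [Ioc_eq_empty (by omega)]
    simp; positivity
  · obtain ⟨k, rfl⟩ := Nat.exists_eq_add_of_le h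
    have := abs_sum_mul_le_of_antitone (c := chiFour) (g := fun n => 1 / n) (C := 1) (a := a + 1)
      (abs_sum_chiFour_le _) (fun n _ => by positivity)
      (fun n hn => by
        have : (0 : ℝ) < n := by exact_mod_cast (by omega : 0 < n)
        push_cast
        exact one_div_le_one_div_of_le this (by linarith)) k
    have e : Ioc a (a + k) = Ico (a + 1) (a + 1 + k) := by
      ext; simp; omega
    rw [e]
    simp only [mul_one_div, Nat.cast_add, Nat.cast_one] at this
    exact this

theorem two_thirds_le_sum_chiFour_div (N : ℕ) (hN : 1 ≤ N) :
    2 / 3 ≤ ∑ n ∈ Ioc 0 N, chiFour n / n := by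
  have h := abs_le.1 (abs_sum_chiFour_div_le 2 N)
  norm_num at h
  rcases Nat.lt_or_ge N 2 with h2 | h2
  · obtain rfl : N = 1 := by omega
    rw [show Ioc 0 1 = {1} by rfl]
    simp [chiFour_eq]; norm_num
  · rw [← sum_Ioc_consecutive _ (by omega : 0 ≤ 2) h2, show Ioc 0 2 = {1, 2} by rfl,
      sum_pair (by norm_num)]
    have h1 : chiFour 1 = 1 := by simp [chiFour_eq]
    have h2 : chiFour 2 = 0 := by simp [chiFour_eq]
    rw [h1, h2]
    norm_num
    linarith

theorem abs_sum_chiFour_mul_log_div_le (N : ℕ) :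
    |∑ n ∈ Ioc 0 N, chiFour n * Real.log n / n| ≤ 1 := by
  have key : ∀ N, |∑ n ∈ Ioc 2 (2 + N), chiFour n * Real.log n / n| ≤ 1 := by
    intro k
    have := abs_sum_mul_le_of_antitone (c := chiFour) (g := fun n => Real.log n / n) (C := 1)
      (a := 3) (abs_sum_chiFour_le _) (fun n _ => by positivity)
      (fun n hn => by
        have h3 : (3 : ℝ) ≤ n := by exact_mod_cast hn
        have he : Real.exp 1 ≤ n := by linarith [Real.exp_one_lt_d9]
        apply Real.log_div_self_antitoneOn he
        · push_cast; simp; linarith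
        · push_cast; linarith) k
    have e : Ioc 2 (2 + k) = Ico 3 (3 + k) := by
      ext; simp; omega
    rw [e]
    simp only [one_mul, ← mul_div_assoc] at this
    refine this.trans ?_
    have := Real.log_le_sub_one_of_pos (x := 3) (by norm_num)
    push_cast
    linarith
  rcases Nat.lt_or_ge N 2 with h2 | h2
  · interval_cases N <;> simp
  · obtain ⟨k, rfl⟩ := Nat.exists_eq_add_of_le h2
    rw [← sum_Ioc_consecutive _ (by omega : 0 ≤ 2) h2, show Ioc 0 2 = {1, 2} by rfl,
      sum_pair (by norm_num)]
    have : chiFour 2 = 0 := by simp [chiFour_eq]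
    simpa [this] using key k

theorem abs_sum_chiFour_mul_vonMangoldt_div_le (N : ℕ) (hN : 1 ≤ N) :
    |∑ n ∈ Ioc 0 N, chiFour n * Λ n / n| ≤ 3 / 2 * (Real.log 4 + 5) := by
  have hN' : (0 : ℝ) < N := by exact_mod_cast hN
  let f : ArithmeticFunction ℝ := ⟨fun n => chiFour n * Λ n / n, by simp⟩
  let g : ArithmeticFunction ℝ := ⟨fun n => chiFour n / n, by simp⟩
  have hfg : ∀ n ∈ Ioc 0 N, (f * g) n = chiFour n * Real.log n / n := by
    intro n hn
    rw [mem_Ioc] at hn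
    rw [mul_apply, ← log_apply, ← vonMangoldt_mul_zeta, mul_apply, mul_sum, sum_div]
    apply sum_congr rfl
    intro x hx
    rw [Nat.mem_divisorsAntidiagonal] at hx
    have h2 : x.2 ≠ 0 := by rintro h; simp [h] at hx; omega
    simp only [f, g, coe_mk, ← hx.1, chiFour_mul, natCoe_apply, zeta_apply_ne h2]
    push_cast
    ring
  have h1 := sum_Ioc_mul_eq_sum_sum f g N
  rw [sum_congr rfl hfg] at h1
  simp only [f, g, coe_mk] at h1
  set M := ∑ n ∈ Ioc 0 N, chiFour n / n with hM
  set S := ∑ n ∈ Ioc 0 N, chiFour n * Λ n / n with hS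
  have h2 : |∑ n ∈ Ioc 0 N, chiFour n * Λ n / n * ∑ m ∈ Ioc 0 (N / n), chiFour m / m - S * M|
      ≤ Real.log 4 + 4 := by
    rw [hS, sum_mul, ← sum_sub_distrib]
    calc _ ≤ ∑ n ∈ Ioc 0 N, Λ n / N := by
          refine (abs_sum_le_sum_abs _ _).trans (sum_le_sum fun n hn => ?_)
          rw [mem_Ioc] at hn
          have hn' : (0 : ℝ) < n := by exact_mod_cast hn.1
          have h3 := abs_sum_chiFour_div_le (N / n) N
          have h4 := sum_Ioc_consecutive (fun m => chiFour m / (m : ℝ)) (Nat.zero_le (N / n))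
            (Nat.div_le_self N n)
          rw [← mul_sub, hM, ← h4, sub_add_cancel_left, abs_mul, abs_neg, abs_div, abs_mul,
            abs_of_nonneg (vonMangoldt_nonneg (n := n)), abs_of_pos hn']
          have h5 : (1 : ℝ) / ((N / n : ℕ) + 1) ≤ n / N := by
            rw [div_le_div_iff₀ (by positivity) hN']
            have := (Nat.lt_div_mul_add hn.1 (a := N)).le
            have h : 1 * N ≤ n * (N / n + 1) := by linarith
            exact_mod_cast h
          have hΛ := vonMangoldt_nonneg (n := n)
          calc _ ≤ 1 * Λ n / n * (n / N) := by
                gcongr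
                · exact abs_chiFour_le n
                · exact h3.trans h5
            _ = Λ n / N := by field_simp
      _ ≤ _ := by
        rw [← sum_div, div_le_iff₀ hN']
        exact sum_vonMangoldt_le N
  rw [← h1] at h2
  have h3 := abs_sum_chiFour_mul_log_div_le N
  have h4 := two_thirds_le_sum_chiFour_div N hN
  rw [← hM] at h4
  have h5 : |S * M| ≤ Real.log 4 + 5 := by
    rw [abs_le] at *
    constructor <;> linarith
  rw [abs_mul, abs_of_pos (by linarith : 0 < M)] at h5
  nlinarith [abs_nonneg S]

end Mertens

section MertensPrimes

open Finset ArithmeticFunction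

theorem summable_vonMangoldt_nonprime_div :
    Summable fun n : ℕ => (if n.Prime then 0 else Λ n) / (n : ℝ) := by
  have := vonMangoldt.summable_residueClass_non_primes_div (q := 1) 0
  refine this.congr fun n => ?_
  simp [vonMangoldt.residueClass, Set.indicator, Subsingleton.elim _ (0 : ZMod 1)]

theorem exists_abs_sum_prime_sub_vonMangoldt_le (w : ℕ → ℝ) (hw : ∀ n, |w n| ≤ 1) :
    ∃ C, ∀ N, |∑ n ∈ Ioc 0 N, (if n.Prime then w n * Real.log n / n else 0) -
      ∑ n ∈ Ioc 0 N, w n * Λ n / n| ≤ C := by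
  refine ⟨∑' n : ℕ, (if n.Prime then 0 else Λ n) / (n : ℝ), fun N => ?_⟩
  rw [← sum_sub_distrib]
  refine (abs_sum_le_sum_abs _ _).trans ?_
  refine (sum_le_sum fun n _ => ?_).trans
    (summable_vonMangoldt_nonprime_div.sum_le_tsum (Ioc 0 N) fun n _ => ?_)
  · split_ifs with h
    · rw [vonMangoldt_apply_prime h]; simp
    · rw [zero_sub, abs_neg, abs_div, abs_mul, Nat.abs_cast,
        abs_of_nonneg (vonMangoldt_nonneg (n := n))]
      have := vonMangoldt_nonneg (n := n)
      gcongr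
      exact mul_le_of_le_one_left this (hw n)
  · have := vonMangoldt_nonneg (n := n)
    split_ifs <;> positivity

/-- The first Mertens theorem for the primes congruent to one modulo four. -/
theorem exists_abs_sum_log_div_one_mod_four_le :
    ∃ C, ∀ N : ℕ, 1 ≤ N → |∑ n ∈ Ioc 0 N, (if n.Prime ∧ n % 4 = 1 then Real.log n / n else 0) -
      1 / 2 * Real.log N| ≤ C := by
  obtain ⟨C₁, h₁⟩ := exists_abs_sum_prime_sub_vonMangoldt_le (fun _ => 1) (by simp)
  obtain ⟨C₂, h₂⟩ := exists_abs_sum_prime_sub_vonMangoldt_le chiFour abs_chiFour_le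
  refine ⟨C₁ + C₂ + (Real.log 4 + 4) + 3 / 2 * (Real.log 4 + 5) + Real.log 2, fun N hN => ?_⟩
  have h3 := abs_sum_vonMangoldt_div_sub_log_le N hN
  have h4 := abs_sum_chiFour_mul_vonMangoldt_div_le N hN
  specialize h₁ N
  specialize h₂ N
  have h5 : ∑ n ∈ Ioc 0 N, (if n.Prime ∧ n % 4 = 1 then Real.log n / n else 0) =
      1 / 2 * ∑ n ∈ Ioc 0 N, (if n.Prime then 1 * Real.log n / n else 0) +
      1 / 2 * ∑ n ∈ Ioc 0 N, (if n.Prime then chiFour n * Real.log n / n else 0) -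
      ∑ n ∈ Ioc 0 N, (if n = 2 then Real.log 2 / 4 else 0) := by
    rw [mul_sum, mul_sum, ← sum_add_distrib, ← sum_sub_distrib]
    apply sum_congr rfl
    intro n _
    by_cases hp : n.Prime
    · rcases hp.eq_two_or_odd with rfl | h
      · simp [chiFour_eq, hp]; ring
      · have hn2 : n ≠ 2 := by rintro rfl; simp at h
        rcases (by omega : n % 4 = 1 ∨ n % 4 = 3) with h' | h'
        · simp [hp, hn2, h', chiFour_eq, h]; ring
        · simp [hp, hn2, h', chiFour_eq, h]; ring
    · have hn2 : n ≠ 2 := by rintro rfl; exact hp Nat.prime_two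
      simp [hp, hn2]
  have h6 : |∑ n ∈ Ioc 0 N, (if n = 2 then Real.log 2 / 4 else (0 : ℝ))| ≤ Real.log 2 := by
    have : 0 < Real.log 2 := Real.log_pos (by norm_num)
    rw [sum_ite_eq']
    split_ifs
    · rw [abs_of_pos (by positivity)]; linarith
    · simp [this.le]
  rw [h5]
  simp only [one_mul] at *
  have hl2 : 0 < Real.log 2 := Real.log_pos (by norm_num)
  have hl4 : 0 < Real.log 4 := Real.log_pos (by norm_num)
  have hC₁ := (abs_nonneg _).trans h₁
  have hC₂ := (abs_nonneg _).trans h₂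
  rw [abs_le] at *
  constructor <;> linarith

/-- The first Mertens theorem for the primes not congruent to one modulo four. -/
theorem exists_abs_sum_log_div_not_one_mod_four_le :
    ∃ C, ∀ N : ℕ, 1 ≤ N → |∑ n ∈ Ioc 0 N, (if n.Prime ∧ n % 4 ≠ 1 then Real.log n / n else 0) -
      1 / 2 * Real.log N| ≤ C := by
  obtain ⟨C₁, h₁⟩ := exists_abs_sum_prime_sub_vonMangoldt_le (fun _ => 1) (by simp)
  obtain ⟨C₂, h₂⟩ := exists_abs_sum_log_div_one_mod_four_le
  refine ⟨C₁ + C₂ + (Real.log 4 + 4), fun N hN => ?_⟩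
  have h3 := abs_sum_vonMangoldt_div_sub_log_le N hN
  specialize h₁ N
  specialize h₂ N hN
  have h5 : ∑ n ∈ Ioc 0 N, (if n.Prime ∧ n % 4 ≠ 1 then Real.log n / n else 0) =
      ∑ n ∈ Ioc 0 N, (if n.Prime then 1 * Real.log n / n else 0) -
      ∑ n ∈ Ioc 0 N, (if n.Prime ∧ n % 4 = 1 then Real.log n / n else 0) := by
    rw [← sum_sub_distrib]
    apply sum_congr rfl
    intro n _
    by_cases hp : n.Prime <;> by_cases h : n % 4 = 1 <;> simp [hp, h]
  rw [h5]
  simp only [one_mul] at *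
  rw [abs_le] at *
  constructor <;> linarith

theorem exists_sum_div_log_le {a : ℕ → ℝ} {C : ℝ}
    (h : ∀ N : ℕ, 1 ≤ N → |∑ n ∈ Ioc 0 N, a n - 1 / 2 * Real.log N| ≤ C) :
    ∃ C', ∀ N : ℕ, 2 ≤ N → ∑ n ∈ Ioc 0 N, a n / Real.log n ≤
      1 / 2 * Real.log (Real.log N) + C' := by
  set c : ℕ → ℝ := fun n => a n - 1 / 2 * (Real.log n - Real.log (n - 1 : ℕ)) with hc
  have htel : ∀ k : ℕ, ∑ n ∈ Ico 3 (3 + k), c n =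
      (∑ n ∈ Ioc 0 (2 + k), a n - 1 / 2 * Real.log (2 + k : ℕ)) -
      (∑ n ∈ Ioc 0 2, a n - 1 / 2 * Real.log (2 : ℕ)) := by
    intro k
    induction k with
    | zero => simp
    | succ k ih =>
      rw [show 3 + (k + 1) = 3 + k + 1 from rfl, sum_Ico_succ_top (by omega), ih,
        show 2 + (k + 1) = 2 + k + 1 from rfl,
        sum_Ioc_succ_top (by omega : 0 ≤ 2 + k), hc]
      simp only [show 3 + k = 2 + k + 1 by omega, Nat.add_sub_cancel]
      ring
  have hbound : ∀ k, |∑ n ∈ Ico 3 (3 + k), c n| ≤ 2 * C := by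
    intro k
    rw [htel]
    have h1 := h (2 + k) (by omega)
    have h2 := h 2 (by omega)
    rw [abs_le] at *
    constructor <;> linarith
  have hlog : ∀ n : ℕ, 2 ≤ n → 0 < Real.log n := fun n hn =>
    Real.log_pos (by exact_mod_cast (by omega : 1 < n))
  have habel := abs_sum_mul_le_of_antitone (c := c) (g := fun n => 1 / Real.log n) hbound
    (fun n hn => (one_div_pos.2 (hlog n (by omega))).le)
    (fun n hn => by
      refine one_div_le_one_div_of_le (hlog n (by omega)) ?_
      apply Real.log_le_log
      · exact_mod_cast (by omega : 0 < n)
      · push_cast; linarith)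
  have hll : ∀ k : ℕ, ∑ n ∈ Ico 3 (3 + k), (Real.log n - Real.log (n - 1 : ℕ)) * (1 / Real.log n) ≤
      Real.log (Real.log (2 + k : ℕ)) - Real.log (Real.log (2 : ℕ)) := by
    intro k
    induction k with
    | zero => simp
    | succ k ih =>
      rw [show 3 + (k + 1) = 3 + k + 1 from rfl, sum_Ico_succ_top (by omega)]
      have h1 := hlog (2 + k) (by omega)
      have h2 := hlog (3 + k) (by omega)
      have h3 := Real.log_le_sub_one_of_pos (div_pos h1 h2)
      rw [Real.log_div h1.ne' h2.ne'] at h3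
      have h4 : (Real.log (3 + k : ℕ) - Real.log (3 + k - 1 : ℕ)) * (1 / Real.log (3 + k : ℕ)) =
          1 - Real.log (2 + k : ℕ) / Real.log (3 + k : ℕ) := by
        rw [show 3 + k - 1 = 2 + k by omega]
        field_simp
      rw [h4, show 2 + (k + 1) = 3 + k by omega]
      linarith
  refine ⟨2 * C * (1 / Real.log 3) + ∑ n ∈ Ioc 0 2, a n / Real.log n -
    1 / 2 * Real.log (Real.log 2), fun N hN => ?_⟩
  obtain ⟨k, rfl⟩ := Nat.exists_eq_add_of_le hN
  rw [← sum_Ioc_consecutive _ (by omega : 0 ≤ 2) hN]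
  have e : Ioc 2 (2 + k) = Ico 3 (3 + k) := by ext; simp; omega
  have e2 : ∑ n ∈ Ico 3 (3 + k), a n / Real.log n =
      ∑ n ∈ Ico 3 (3 + k), c n * (1 / Real.log n) +
      1 / 2 * ∑ n ∈ Ico 3 (3 + k), (Real.log n - Real.log (n - 1 : ℕ)) * (1 / Real.log n) := by
    rw [mul_sum, ← sum_add_distrib]
    apply sum_congr rfl
    intro n _
    rw [hc]; ring
  rw [e, e2]
  have h1 := (abs_le.1 (habel k)).2
  have h2 := hll k
  push_cast at *
  linarith

theorem exists_sum_prime_inv_le (P : ℕ → Prop) [DecidablePred P]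
    (h : ∃ C, ∀ N : ℕ, 1 ≤ N → |∑ n ∈ Ioc 0 N, (if n.Prime ∧ P n then Real.log n / n else 0) -
      1 / 2 * Real.log N| ≤ C) :
    ∃ C, ∀ N : ℕ, 2 ≤ N → ∑ p ∈ Ioc 0 N with p.Prime ∧ P p, 1 / (p : ℝ) ≤
      1 / 2 * Real.log (Real.log N) + C := by
  obtain ⟨C, hC⟩ := h
  obtain ⟨C', hC'⟩ := exists_sum_div_log_le hC
  refine ⟨C', fun N hN => ?_⟩
  refine le_trans (le_of_eq ?_) (hC' N hN)
  rw [sum_filter]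
  apply sum_congr rfl
  intro n _
  split_ifs with hp
  · have : 0 < Real.log n := Real.log_pos (by exact_mod_cast hp.1.one_lt)
    field_simp
  · simp

/-- A Chebyshev lower bound for the primes congruent to one modulo four. -/
theorem exists_le_sum_log_one_mod_four :
    ∃ K : ℕ, 1 ≤ K ∧ ∀ N : ℕ, K ≤ N →
      (N : ℝ) / K ≤ ∑ p ∈ Ioc 0 N with p.Prime ∧ p % 4 = 1, Real.log p := by
  obtain ⟨C, hC⟩ := exists_abs_sum_log_div_one_mod_four_le
  obtain ⟨K, hK⟩ := exists_nat_ge (Real.exp (4 * C + 2))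
  have hK0 : (0 : ℝ) < K := (Real.exp_pos _).trans_le hK
  have hK1 : 1 ≤ K := by exact_mod_cast hK0
  have hlogK : 4 * C + 2 ≤ Real.log K := (Real.le_log_iff_exp_le hK0).2 hK
  refine ⟨K, hK1, fun N hN => ?_⟩
  have hM : 1 ≤ N / K := Nat.div_pos hN hK1
  have hM0 : (0 : ℝ) < (N / K : ℕ) := by exact_mod_cast hM
  have hN0 : (0 : ℝ) < N := by exact_mod_cast (by omega : 0 < N)
  have h1 := (abs_le.1 (hC N (by omega))).1
  have h2 := (abs_le.1 (hC (N / K) hM)).2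
  rw [← sum_Ioc_consecutive _ (Nat.zero_le (N / K)) (Nat.div_le_self N K)] at h1
  have h3 : Real.log (N / K : ℕ) ≤ Real.log N - Real.log K := by
    rw [← Real.log_div hN0.ne' hK0.ne']
    exact Real.log_le_log hM0 Nat.cast_div_le
  have h4 : 1 ≤ ∑ n ∈ Ioc (N / K) N, (if n.Prime ∧ n % 4 = 1 then Real.log n / n else 0) := by
    linarith
  have h5 : ∑ n ∈ Ioc (N / K) N, (if n.Prime ∧ n % 4 = 1 then Real.log n / n else (0 : ℝ)) ≤
      ∑ n ∈ Ioc (N / K) N, (if n.Prime ∧ n % 4 = 1 then Real.log n else 0) * (K / N) := by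
    apply sum_le_sum
    intro n hn
    rw [mem_Ioc] at hn
    have hn0 : (0 : ℝ) < n := by exact_mod_cast (by omega : 0 < n)
    split_ifs
    · rw [div_eq_mul_inv]
      gcongr
      rw [inv_le_comm₀ hn0 (by positivity), inv_div, div_le_iff₀ hK0]
      have := (Nat.lt_div_mul_add hK1 (a := N)).le
      have h6 : N ≤ n * K := by
        calc N ≤ (N / K + 1) * K := by linarith
          _ ≤ n * K := Nat.mul_le_mul_right _ hn.1
      exact_mod_cast h6
    · simp
  rw [← sum_mul] at h5
  have h6 : ∑ n ∈ Ioc (N / K) N, (if n.Prime ∧ n % 4 = 1 then Real.log n else (0 : ℝ)) ≤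
      ∑ n ∈ Ioc 0 N, (if n.Prime ∧ n % 4 = 1 then Real.log n else 0) := by
    apply sum_le_sum_of_subset_of_nonneg
    · intro n; simp; omega
    · intro n _ _; split_ifs <;> positivity
  rw [sum_filter]
  have h7 := h4.trans (h5.trans (mul_le_mul_of_nonneg_right h6 (by positivity)))
  rw [div_le_iff₀ hK0]
  rw [← mul_div_assoc, le_div_iff₀ hN0] at h7
  linarith

end MertensPrimes

section MultiplicativeSums

open Finset ArithmeticFunction

/-- Nonnegative multiplicative functions of divisor type: `f (p ^ k) ≤ k + 1`. -/
structure IsDivisorBounded (f : ℕ → ℝ) : Prop where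
  one : f 1 = 1
  mul : ∀ {m n : ℕ}, m.Coprime n → f (m * n) = f m * f n
  nonneg : ∀ n, 0 ≤ f n
  le : ∀ {p : ℕ} (k : ℕ), p.Prime → f (p ^ k) ≤ k + 1

theorem hasSum_add_three_mul_half_pow : HasSum (fun k : ℕ => ((k : ℝ) + 3) * (1 / 2) ^ k) 8 := by
  have h1 := hasSum_coe_mul_geometric_of_norm_lt_one (𝕜 := ℝ) (r := 1 / 2) (by norm_num)
  have h2 := (hasSum_geometric_of_lt_one (r := (1 / 2 : ℝ)) (by norm_num) (by norm_num)).mul_left 3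
  convert! h1.add h2 using 1
  · ext k; ring
  · norm_num

theorem summable_and_tsum_le_exp {c : ℕ → ℝ} {x r : ℝ} (hnn : ∀ k, 0 ≤ c k) (h0 : c 0 = 1)
    (h1 : c 1 = x) (hle : ∀ k : ℕ, c (k + 2) ≤ r * (((k : ℝ) + 3) * (1 / 2) ^ k)) :
    Summable c ∧ ∑' k, c k ≤ Real.exp (x + 8 * r) := by
  have hs := hasSum_add_three_mul_half_pow.mul_left r
  have hsum2 : Summable (fun k : ℕ => c (k + 2)) :=
    hs.summable.of_nonneg_of_le (fun k => hnn _) hle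
  have hsum := (summable_nat_add_iff 2).1 hsum2
  refine ⟨hsum, ?_⟩
  rw [← hsum.sum_add_tsum_nat_add 2]
  have h3 := hsum2.tsum_le_tsum hle hs.summable
  rw [hs.tsum_eq] at h3
  rw [sum_range_succ, sum_range_one, h0, h1]
  have h4 := Real.add_one_le_exp (x + 8 * r)
  linarith

theorem IsDivisorBounded.summable_and_tsum_le {f : ℕ → ℝ} (hf : IsDivisorBounded f) {p : ℕ}
    (hp : p.Prime) : Summable (fun k : ℕ => f (p ^ k) / (p ^ k : ℕ)) ∧
      ∑' k : ℕ, f (p ^ k) / (p ^ k : ℕ) ≤ Real.exp (f p / p + 8 * (1 / (p : ℝ) ^ 2)) := by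
  have hp2 : (2 : ℝ) ≤ p := by exact_mod_cast hp.two_le
  have hle : ∀ k : ℕ, f (p ^ (k + 2)) / (p ^ (k + 2) : ℕ) ≤
      1 / (p : ℝ) ^ 2 * (((k : ℝ) + 3) * (1 / 2) ^ k) := by
    intro k
    have h1 := hf.le (k + 2) hp
    have h2 : (2 : ℝ) ^ k ≤ (p : ℝ) ^ k := by gcongr
    push_cast at *
    rw [div_le_iff₀ (by positivity)]
    calc f (p ^ (k + 2)) ≤ ((k : ℝ) + 3) * 1 := by linarith
      _ ≤ ((k : ℝ) + 3) * ((p : ℝ) ^ k / 2 ^ k) := by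
          gcongr
          rw [one_le_div (by positivity)]; exact h2
      _ = _ := by rw [pow_add, one_div_pow]; field_simp
  exact summable_and_tsum_le_exp (c := fun k => f (p ^ k) / (p ^ k : ℕ))
    (fun k => div_nonneg (hf.nonneg _) (Nat.cast_nonneg _)) (by simp [hf.one]) (by simp) hle

/-- Logarithmic means of divisor-bounded multiplicative functions. -/
theorem exists_sum_div_le_exp : ∃ C > 0, ∀ f, IsDivisorBounded f → ∀ N : ℕ,
    ∑ n ∈ Ioc 0 N, f n / n ≤ C * Real.exp (∑ p ∈ Ioc 0 N with p.Prime, f p / p) := by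
  have hsq : Summable (fun n : ℕ => 8 * (1 / (n : ℝ) ^ 2)) :=
    (Real.summable_one_div_nat_pow.2 (by norm_num)).mul_left 8
  refine ⟨Real.exp (∑' n : ℕ, 8 * (1 / (n : ℝ) ^ 2)), Real.exp_pos _, fun f hf N => ?_⟩
  have hF := EulerProduct.summable_and_hasSum_factoredNumbers_prod_filter_prime_tsum
    (f := fun n => f n / n) (by simp [hf.one])
    (fun {m n} h => by rw [hf.mul h]; push_cast; rw [mul_div_mul_comm])
    (fun {p} hp => by
      simpa only [Real.norm_of_nonneg (div_nonneg (hf.nonneg _) (Nat.cast_nonneg _))] using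
        (hf.summable_and_tsum_le hp).1) (Ioc 0 N)
  have h1 : ∑ n ∈ Ioc 0 N, f n / n ≤ ∑' m : Nat.factoredNumbers (Ioc 0 N), f m / (m : ℕ) := by
    have hmem : ∀ n ∈ Ioc 0 N, n ∈ Nat.factoredNumbers (Ioc 0 N) := by
      intro n hn
      rw [mem_Ioc] at hn
      rw [Nat.mem_factoredNumbers']
      intro p hp hpn
      rw [mem_Ioc]
      exact ⟨hp.pos, (Nat.le_of_dvd hn.1 hpn).trans hn.2⟩
    have := hF.2.summable.sum_le_tsum
      ((Ioc 0 N).subtype (· ∈ Nat.factoredNumbers (Ioc 0 N)))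
      (fun m _ => div_nonneg (hf.nonneg _) (Nat.cast_nonneg _))
    rwa [sum_subtype_of_mem (fun n : ℕ => f n / n) hmem] at this
  rw [hF.2.tsum_eq] at h1
  refine h1.trans ?_
  calc _ ≤ ∏ p ∈ Ioc 0 N with p.Prime, Real.exp (f p / p + 8 * (1 / (p : ℝ) ^ 2)) := by
        apply Finset.prod_le_prod
        · intro p _
          exact tsum_nonneg fun k => div_nonneg (hf.nonneg _) (Nat.cast_nonneg _)
        · intro p hp
          exact (hf.summable_and_tsum_le (mem_filter.1 hp).2).2
    _ = Real.exp (∑ p ∈ Ioc 0 N with p.Prime, 8 * (1 / (p : ℝ) ^ 2)) *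
        Real.exp (∑ p ∈ Ioc 0 N with p.Prime, f p / p) := by
        rw [← Real.exp_sum, sum_add_distrib, Real.exp_add, mul_comm]
    _ ≤ _ := by
        gcongr
        exact hsq.sum_le_tsum _ fun n _ => by positivity

theorem sq_mul_succ_le (k : ℕ) : (k * (k + 1)) ^ 2 ≤ 36 * 2 ^ k := by
  rcases Nat.lt_or_ge k 5 with h | h
  · interval_cases k <;> norm_num
  · induction k, h using Nat.le_induction with
    | base => norm_num
    | succ k hk ih =>
      have h1 : (k + 2) ^ 2 ≤ 2 * k ^ 2 := by nlinarith
      calc ((k + 1) * (k + 1 + 1)) ^ 2 = (k + 1) ^ 2 * (k + 2) ^ 2 := by ring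
        _ ≤ (k + 1) ^ 2 * (2 * k ^ 2) := Nat.mul_le_mul_left _ h1
        _ = 2 * (k * (k + 1)) ^ 2 := by ring
        _ ≤ 2 * (36 * 2 ^ k) := Nat.mul_le_mul_left _ ih
        _ = _ := by ring

theorem exists_sum_primePow_mul_log_le : ∃ C > 0, ∀ f, IsDivisorBounded f → ∀ y : ℕ,
    ∑ d ∈ Ioc 0 y, (if IsPrimePow d then f d * Real.log d else 0) ≤ C * y := by
  obtain ⟨C, hC⟩ := Chebyshev.psi_sub_theta_le_mul_sqrt
  refine ⟨2 * (Real.log 4 + 4) + 6 * |C|, ?_, fun f hf y => ?_⟩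
  · have : 0 < Real.log 4 := Real.log_pos (by norm_num)
    positivity
  have hterm : ∀ d ∈ Ioc 0 y, (if IsPrimePow d then f d * Real.log d else 0) ≤
      2 * Λ d + 6 * √y * (if ¬ d.Prime then Λ d else 0) := by
    intro d hd
    rw [mem_Ioc] at hd
    have hΛ := vonMangoldt_nonneg (n := d)
    split_ifs with h1 h2 h2
    · have := hf.le 1 h2
      rw [vonMangoldt_apply_prime h2] at *
      norm_num at this ⊢
      gcongr
    · obtain ⟨p, k, hp, hk, rfl⟩ := (isPrimePow_nat_iff _).1 h1
      have h3 := hf.le k hp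
      have hlogp : 0 ≤ Real.log p := by positivity
      have h4 : (k * (k + 1) : ℝ) ≤ 6 * √y := by
        apply le_of_sq_le_sq _ (by positivity)
        rw [mul_pow 6, Real.sq_sqrt (by positivity)]
        have h5 : (2 : ℕ) ^ k ≤ y := (Nat.pow_le_pow_left hp.two_le k).trans hd.2
        have h6 := (sq_mul_succ_le k).trans (Nat.mul_le_mul_left 36 h5)
        have h7 : ((k : ℝ) * (k + 1)) ^ 2 ≤ 36 * y := by exact_mod_cast h6
        linarith
      rw [vonMangoldt_apply_pow hk.ne', vonMangoldt_apply_prime hp] at *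
      push_cast
      rw [Real.log_pow]
      calc f (p ^ k) * (k * Real.log p) ≤ (k + 1) * (k * Real.log p) := by gcongr
        _ = (k * (k + 1)) * Real.log p := by ring
        _ ≤ 6 * √y * Real.log p := by gcongr
        _ ≤ _ := by linarith
    · positivity
    · positivity
  refine (sum_le_sum hterm).trans ?_
  rw [sum_add_distrib, ← mul_sum, ← mul_sum, ← sum_filter]
  have h1 := sum_vonMangoldt_le y
  have h2 := Chebyshev.psi_sub_theta_eq_sum_not_prime y
  rw [Nat.floor_natCast] at h2
  rw [← h2]
  have h3 := hC y
  have h4 : 6 * √y * (Chebyshev.psi y - Chebyshev.theta y) ≤ 6 * √y * (|C| * √y) := by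
    gcongr
    exact h3.trans (by gcongr; exact le_abs_self C)
  have h5 : 6 * √(y : ℝ) * (|C| * √y) = 6 * |C| * y := by
    rw [show 6 * √(y : ℝ) * (|C| * √y) = 6 * |C| * (√y * √y) by ring,
      Real.mul_self_sqrt (by positivity)]
  linarith

theorem IsDivisorBounded.sum_mul_log_le {f : ℕ → ℝ} (hf : IsDivisorBounded f) (N : ℕ) :
    ∑ n ∈ Ioc 0 N, f n * Real.log n ≤
      ∑ m ∈ Ioc 0 N, f m * ∑ d ∈ Ioc 0 (N / m), (if IsPrimePow d then f d * Real.log d else 0) := by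
  have hexp : ∀ n ∈ Ioc 0 N, f n * Real.log n = ∑ p ∈ n.primeFactors,
      f (ordCompl[p] n) * (f (ordProj[p] n) * Real.log (ordProj[p] n : ℕ)) := by
    intro n hn
    rw [mem_Ioc] at hn
    have h1 : Real.log n = ∑ p ∈ n.primeFactors, Real.log (ordProj[p] n : ℕ) := by
      conv_lhs => rw [← Nat.prod_factorization_pow_eq_self hn.1.ne']
      rw [Finsupp.prod, Nat.support_factorization]
      push_cast
      rw [Real.log_prod]
      intro p hp
      have := (Nat.prime_of_mem_primeFactors hp).pos
      positivity
    rw [h1, mul_sum]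
    apply sum_congr rfl
    intro p hp
    have hp' := Nat.prime_of_mem_primeFactors hp
    conv_lhs => rw [← Nat.ordProj_mul_ordCompl_eq_self n p]
    rw [hf.mul ((Nat.coprime_ordCompl hp' hn.1.ne').pow_left _)]
    rw [Nat.ordProj_mul_ordCompl_eq_self]
    ring
  rw [sum_congr rfl hexp, sum_sigma']
  simp_rw [mul_sum]
  rw [sum_sigma']
  set e : (Σ _ : ℕ, ℕ) → (Σ _ : ℕ, ℕ) := fun x => ⟨ordCompl[x.2] x.1, ordProj[x.2] x.1⟩ with he
  have hpp : ∀ x ∈ (Ioc 0 N).sigma fun n => n.primeFactors,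
      x.2.Prime ∧ x.1.factorization x.2 ≠ 0 ∧ 0 < x.1 ∧ x.1 ≤ N := by
    intro x hx
    rw [mem_sigma, mem_Ioc] at hx
    have hp := Nat.prime_of_mem_primeFactors hx.2
    exact ⟨hp, (hp.factorization_pos_of_dvd hx.1.1.ne' (Nat.dvd_of_mem_primeFactors hx.2)).ne',
      hx.1⟩
  have hinj : Set.InjOn e ((Ioc 0 N).sigma fun n => n.primeFactors : Finset _) := by
    intro x hx y hy hxy
    obtain ⟨hpx, hvx, -⟩ := hpp x hx
    obtain ⟨hpy, hvy, -⟩ := hpp y hy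
    simp only [he, Sigma.mk.injEq, heq_eq_eq] at hxy
    obtain ⟨h1, h2⟩ := hxy
    have h3 : x.1 = y.1 := by
      rw [← Nat.ordProj_mul_ordCompl_eq_self x.1 x.2, h1, h2, Nat.ordProj_mul_ordCompl_eq_self]
    have h4 : x.2 = y.2 := by
      have := congrArg Nat.minFac h2
      rwa [hpx.pow_minFac hvx, hpy.pow_minFac hvy] at this
    cases x; cases y; simp_all
  calc _ = ∑ x ∈ (Ioc 0 N).sigma fun n => n.primeFactors,
        f (e x).1 * (if IsPrimePow (e x).2 then f (e x).2 * Real.log (e x).2 else 0) := by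
        apply sum_congr rfl
        intro x hx
        obtain ⟨hpx, hvx, -⟩ := hpp x hx
        rw [if_pos (hpx.isPrimePow.pow hvx)]
    _ = ∑ x ∈ ((Ioc 0 N).sigma fun n => n.primeFactors).image e,
        f x.1 * (if IsPrimePow x.2 then f x.2 * Real.log x.2 else 0) := by
        rw [sum_image hinj]
    _ ≤ _ := by
        apply sum_le_sum_of_subset_of_nonneg
        · intro z hz
          rw [mem_image] at hz
          obtain ⟨x, hx, rfl⟩ := hz
          obtain ⟨hpx, hvx, h0, hN⟩ := hpp x hx
          have hc := Nat.ordCompl_pos x.2 h0.ne'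
          rw [mem_sigma, mem_Ioc, mem_Ioc]
          refine ⟨⟨hc, (Nat.ordCompl_le _ _).trans hN⟩, Nat.ordProj_pos _ _, ?_⟩
          rw [Nat.le_div_iff_mul_le hc]
          simp only [he]
          rw [Nat.ordProj_mul_ordCompl_eq_self]
          exact hN
        · intro x _ _
          have := hf.nonneg x.1
          have := hf.nonneg x.2
          split_ifs <;> positivity

/-- An upper bound of Hall–Tenenbaum type for sums of multiplicative functions. -/
theorem exists_sum_mul_log_le_exp : ∃ C > 0, ∀ f, IsDivisorBounded f → ∀ N : ℕ,
    (∑ n ∈ Ioc 0 N, f n) * Real.log N ≤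
      C * N * Real.exp (∑ p ∈ Ioc 0 N with p.Prime, f p / p) := by
  obtain ⟨C₁, hC₁, h₁⟩ := exists_sum_div_le_exp
  obtain ⟨C₂, hC₂, h₂⟩ := exists_sum_primePow_mul_log_le
  refine ⟨(C₂ + 1) * C₁, by positivity, fun f hf N => ?_⟩
  have h3 : (∑ n ∈ Ioc 0 N, f n) * Real.log N ≤ (C₂ + 1) * (N * ∑ n ∈ Ioc 0 N, f n / n) := by
    have h4 := hf.sum_mul_log_le N
    have h5 : ∑ m ∈ Ioc 0 N, f m *
        ∑ d ∈ Ioc 0 (N / m), (if IsPrimePow d then f d * Real.log d else 0) ≤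
        C₂ * (N * ∑ n ∈ Ioc 0 N, f n / n) := by
      rw [mul_sum, mul_sum]
      apply sum_le_sum
      intro m _
      calc _ ≤ f m * (C₂ * (N / m : ℕ)) := mul_le_mul_of_nonneg_left (h₂ f hf _) (hf.nonneg m)
        _ ≤ f m * (C₂ * (N / m : ℝ)) := by
            have := hf.nonneg m
            gcongr
            exact Nat.cast_div_le
        _ = _ := by ring
    have h6 : (∑ n ∈ Ioc 0 N, f n) * Real.log N ≤
        ∑ n ∈ Ioc 0 N, f n * Real.log n + N * ∑ n ∈ Ioc 0 N, f n / n := by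
      rw [sum_mul, mul_sum, ← sum_add_distrib]
      apply sum_le_sum
      intro n hn
      rw [mem_Ioc] at hn
      have hn0 : (0 : ℝ) < n := by exact_mod_cast hn.1
      have hN0 : (0 : ℝ) < N := by exact_mod_cast hn.1.trans_le hn.2
      have h7 := Real.log_le_sub_one_of_pos (div_pos hN0 hn0)
      rw [Real.log_div hN0.ne' hn0.ne'] at h7
      have h8 := mul_le_mul_of_nonneg_left h7 (hf.nonneg n)
      have h9 := hf.nonneg n
      have : f n * (N / n - 1 : ℝ) = N * (f n / n) - f n := by ring
      linarith
    linarith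
  refine h3.trans ?_
  calc _ ≤ (C₂ + 1) * (N * (C₁ * Real.exp (∑ p ∈ Ioc 0 N with p.Prime, f p / p))) := by
        gcongr
        exact h₁ f hf N
    _ = _ := by ring

end MultiplicativeSums

section LowerBound

open Finset
open scoped Classical

/-- All prime factors satisfy `P`. -/
def PrimeFactorsIn (P : ℕ → Prop) (n : ℕ) : Prop := ∀ p : ℕ, p.Prime → p ∣ n → P p

theorem PrimeFactorsIn.mul_iff {P : ℕ → Prop} {m n : ℕ} :
    PrimeFactorsIn P (m * n) ↔ PrimeFactorsIn P m ∧ PrimeFactorsIn P n := by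
  constructor
  · intro h
    exact ⟨fun p hp hd => h p hp (hd.mul_right n), fun p hp hd => h p hp (hd.mul_left m)⟩
  · rintro ⟨h1, h2⟩ p hp hd
    exact (hp.dvd_mul.1 hd).elim (h1 p hp) (h2 p hp)

theorem primeFactorsIn_one (P : ℕ → Prop) : PrimeFactorsIn P 1 := fun _ hp hd =>
  (hp.one_lt.ne' (Nat.dvd_one.1 hd)).elim

theorem primeFactorsIn_prime_iff {P : ℕ → Prop} {p : ℕ} (hp : p.Prime) :
    PrimeFactorsIn P p ↔ P p := by
  constructor
  · intro h; exact h p hp dvd_rfl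
  · intro h q hq hd; rwa [(Nat.prime_dvd_prime_iff_eq hq hp).1 hd]

theorem isDivisorBounded_primeFactorsIn (P : ℕ → Prop) :
    IsDivisorBounded (fun n => if PrimeFactorsIn P n then 1 else 0) where
  one := if_pos (primeFactorsIn_one P)
  mul {m n} _ := by
    by_cases h1 : PrimeFactorsIn P m <;> by_cases h2 : PrimeFactorsIn P n <;>
      simp [PrimeFactorsIn.mul_iff, h1, h2]
  nonneg n := by split_ifs <;> norm_num
  le k _ := by split_ifs <;> linarith [(Nat.cast_nonneg k : (0 : ℝ) ≤ k)]

theorem exists_mul_primeFactorsIn (P : ℕ → Prop) (n : ℕ) (hn : n ≠ 0) :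
    ∃ a b, n = a * b ∧ PrimeFactorsIn P a ∧ PrimeFactorsIn (fun p => ¬ P p) b := by
  induction n using Nat.recOnMul with
  | zero => exact (hn rfl).elim
  | one => exact ⟨1, 1, rfl, primeFactorsIn_one _, primeFactorsIn_one _⟩
  | prime p hp =>
    by_cases h : P p
    · exact ⟨p, 1, (mul_one p).symm, (primeFactorsIn_prime_iff hp).2 h, primeFactorsIn_one _⟩
    · exact ⟨1, p, (one_mul p).symm, primeFactorsIn_one _, (primeFactorsIn_prime_iff hp).2 h⟩
  | mul x y hx hy =>
    obtain ⟨a, b, h1, h2, h3⟩ := hx (left_ne_zero_of_mul hn)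
    obtain ⟨c, d, h4, h5, h6⟩ := hy (right_ne_zero_of_mul hn)
    exact ⟨a * c, b * d, by rw [h1, h4]; ring, PrimeFactorsIn.mul_iff.2 ⟨h2, h5⟩,
      PrimeFactorsIn.mul_iff.2 ⟨h3, h6⟩⟩

theorem log_le_sum_primeFactorsIn_mul (P : ℕ → Prop) (N : ℕ) :
    Real.log N ≤ (∑ a ∈ Ioc 0 N with PrimeFactorsIn P a, 1 / (a : ℝ)) *
      ∑ b ∈ Ioc 0 N with PrimeFactorsIn (fun p => ¬ P p) b, 1 / (b : ℝ) := by
  have h1 : Real.log N ≤ ∑ n ∈ Ioc 0 N, 1 / (n : ℝ) := by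
    rcases Nat.eq_zero_or_pos N with rfl | hN
    · simp
    have h := log_add_one_le_harmonic N
    rw [harmonic_eq_sum_Icc] at h
    push_cast at h
    have e : Icc 1 N = Ioc 0 N := by ext; simp; omega
    rw [e] at h
    simp only [one_div]
    refine le_trans ?_ h
    apply Real.log_le_log
    · exact_mod_cast hN
    · linarith
  refine h1.trans ?_
  have hex : ∀ n : ℕ, ∃ x : ℕ × ℕ, n ≠ 0 → n = x.1 * x.2 ∧ PrimeFactorsIn P x.1 ∧
      PrimeFactorsIn (fun p => ¬ P p) x.2 := by
    intro n
    by_cases hn : n = 0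
    · exact ⟨0, fun h => (h hn).elim⟩
    · obtain ⟨a, b, h⟩ := exists_mul_primeFactorsIn P n hn
      exact ⟨(a, b), fun _ => h⟩
  choose e he using hex
  have hmem : ∀ n ∈ Ioc 0 N, n ≠ 0 := fun n hn => (mem_Ioc.1 hn).1.ne'
  have hinj : Set.InjOn e (Ioc 0 N : Finset ℕ) := by
    intro x hx y hy hxy
    rw [(he x (hmem x hx)).1, (he y (hmem y hy)).1, hxy]
  rw [sum_mul_sum, ← sum_product']
  calc _ = ∑ n ∈ Ioc 0 N, 1 / ((e n).1 : ℝ) * (1 / ((e n).2 : ℝ)) := by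
        apply sum_congr rfl
        intro n hn
        conv_lhs => rw [(he n (hmem n hn)).1]
        push_cast
        rw [one_div_mul_one_div]
    _ = ∑ x ∈ (Ioc 0 N).image e, 1 / (x.1 : ℝ) * (1 / (x.2 : ℝ)) := by
        rw [sum_image hinj]
    _ ≤ _ := by
        apply sum_le_sum_of_subset_of_nonneg
        · intro z hz
          rw [mem_image] at hz
          obtain ⟨n, hn, rfl⟩ := hz
          have h0 := hmem n hn
          obtain ⟨h2, h3, h4⟩ := he n h0
          have ha : (e n).1 ≠ 0 := fun h => h0 (by rw [h2, h, zero_mul])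
          have hb : (e n).2 ≠ 0 := fun h => h0 (by rw [h2, h, mul_zero])
          have hN := (mem_Ioc.1 hn).2
          rw [mem_product, mem_filter, mem_filter, mem_Ioc, mem_Ioc]
          refine ⟨⟨⟨ha.bot_lt, ?_⟩, h3⟩, ⟨⟨hb.bot_lt, ?_⟩, h4⟩⟩
          · exact (Nat.le_of_dvd h0.bot_lt (Dvd.intro _ h2.symm)).trans hN
          · exact (Nat.le_of_dvd h0.bot_lt (Dvd.intro_left _ h2.symm)).trans hN
        · intro x _ _; positivity

theorem exists_sqrt_log_le_sum_one_mod_four : ∃ c > 0, ∀ N : ℕ, 2 ≤ N →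
    c * √(Real.log N) ≤ ∑ a ∈ Ioc 0 N with PrimeFactorsIn (fun p => p % 4 = 1) a, 1 / (a : ℝ) := by
  obtain ⟨C₁, hC₁, h₁⟩ := exists_sum_div_le_exp
  obtain ⟨C₂, h₂⟩ := exists_sum_prime_inv_le (fun n => n % 4 ≠ 1)
    exists_abs_sum_log_div_not_one_mod_four_le
  refine ⟨1 / (C₁ * Real.exp C₂), by positivity, fun N hN => ?_⟩
  have hlog : 0 < Real.log N := Real.log_pos (by exact_mod_cast (by omega : 1 < N))
  have h3 := log_le_sum_primeFactorsIn_mul (fun p => p % 4 = 1) N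
  have h4 := h₁ _ (isDivisorBounded_primeFactorsIn (fun p => ¬ p % 4 = 1)) N
  have h5 : ∑ p ∈ Ioc 0 N with p.Prime,
      (if PrimeFactorsIn (fun p => ¬ p % 4 = 1) p then (1 : ℝ) else 0) / p =
      ∑ p ∈ Ioc 0 N with p.Prime ∧ p % 4 ≠ 1, 1 / (p : ℝ) := by
    rw [sum_filter, sum_filter]
    apply sum_congr rfl
    intro p _
    by_cases hp : p.Prime
    · by_cases h : p % 4 = 1 <;> simp [hp, primeFactorsIn_prime_iff hp, h]
    · simp [hp]
  rw [h5] at h4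
  have h6 : Real.exp (∑ p ∈ Ioc 0 N with p.Prime ∧ p % 4 ≠ 1, 1 / (p : ℝ)) ≤
      √(Real.log N) * Real.exp C₂ := by
    refine (Real.exp_le_exp.2 (h₂ N hN)).trans (le_of_eq ?_)
    rw [Real.exp_add, Real.sqrt_eq_rpow, Real.rpow_def_of_pos hlog]
    congr 2
    ring
  have h7 : ∑ b ∈ Ioc 0 N with PrimeFactorsIn (fun p => ¬ p % 4 = 1) b, 1 / (b : ℝ) ≤
      C₁ * Real.exp C₂ * √(Real.log N) := by
    calc _ = ∑ n ∈ Ioc 0 N,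
          (if PrimeFactorsIn (fun p => ¬ p % 4 = 1) n then (1 : ℝ) else 0) / n := by
          rw [sum_filter]
          apply sum_congr rfl
          intro n _
          split_ifs <;> simp
      _ ≤ _ := h4
      _ ≤ C₁ * (√(Real.log N) * Real.exp C₂) := by gcongr
      _ = _ := by ring
  set A := ∑ a ∈ Ioc 0 N with PrimeFactorsIn (fun p => p % 4 = 1) a, 1 / (a : ℝ)
  have hA : 0 ≤ A := sum_nonneg fun _ _ => by positivity
  have h8 := h3.trans (mul_le_mul_of_nonneg_left h7 hA)
  have hs : 0 < √(Real.log N) := Real.sqrt_pos.2 hlog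
  have h9 : √(Real.log N) * √(Real.log N) ≤ (A * (C₁ * Real.exp C₂)) * √(Real.log N) := by
    rw [Real.mul_self_sqrt hlog.le]; linarith
  have h10 := le_of_mul_le_mul_right h9 hs
  rw [one_div, inv_mul_le_iff₀ (by positivity)]
  linarith

theorem sum_sum_log_le_card_mul_log (P : ℕ → Prop) (N : ℕ) :
    ∑ m ∈ Ioc 0 N with PrimeFactorsIn P m, ∑ p ∈ Ioc 0 (N / m) with p.Prime ∧ P p, Real.log p ≤
      #{n ∈ Ioc 0 N | PrimeFactorsIn P n} * Real.log N := by
  have h1 : ∑ n ∈ Ioc 0 N with PrimeFactorsIn P n, ∑ p ∈ n.primeFactors, Real.log p ≤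
      #{n ∈ Ioc 0 N | PrimeFactorsIn P n} * Real.log N := by
    rw [← nsmul_eq_mul]
    apply sum_le_card_nsmul
    intro n hn
    rw [mem_filter, mem_Ioc] at hn
    have hne : ∀ p ∈ n.primeFactors, (p : ℝ) ≠ 0 := fun p hp => by
      exact_mod_cast (Nat.prime_of_mem_primeFactors hp).ne_zero
    rw [← Real.log_prod hne, ← Nat.cast_prod]
    apply Real.log_le_log
    · exact_mod_cast Finset.prod_pos fun p hp => (Nat.prime_of_mem_primeFactors hp).pos
    · exact_mod_cast (Nat.le_of_dvd hn.1.1 (Nat.prod_primeFactors_dvd n)).trans hn.1.2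
  refine le_trans ?_ h1
  rw [sum_sigma', sum_sigma']
  set S := (({m ∈ Ioc 0 N | PrimeFactorsIn P m}).sigma
    fun m => {p ∈ Ioc 0 (N / m) | p.Prime ∧ P p}) with hS
  set e : (Σ _ : ℕ, ℕ) → (Σ _ : ℕ, ℕ) := fun x => ⟨x.1 * x.2, x.2⟩ with he
  have hmem : ∀ x ∈ S, (0 < x.1 ∧ x.1 ≤ N) ∧ PrimeFactorsIn P x.1 ∧ x.2 ≤ N / x.1 ∧
      x.2.Prime ∧ P x.2 := by
    intro x hx
    simp only [hS, mem_sigma, mem_filter, mem_Ioc] at hx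
    exact ⟨hx.1.1, hx.1.2, hx.2.1.2, hx.2.2⟩
  have hinj : Set.InjOn e S := by
    rintro ⟨x, p⟩ hx ⟨y, q⟩ hy hxy
    simp only [he, Sigma.mk.injEq, heq_eq_eq] at hxy
    obtain ⟨h2, rfl⟩ := hxy
    have hp := (hmem _ hx).2.2.2.1.pos
    rw [Nat.eq_of_mul_eq_mul_right hp h2]
  calc _ = ∑ x ∈ S.image e, Real.log x.2 := by rw [sum_image hinj]
    _ ≤ _ := by
      apply sum_le_sum_of_subset_of_nonneg
      · intro z hz
        rw [mem_image] at hz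
        obtain ⟨x, hx, rfl⟩ := hz
        obtain ⟨⟨h2, h3⟩, h4, h5, h6, h7⟩ := hmem x hx
        rw [Nat.le_div_iff_mul_le h2] at h5
        simp only [he, mem_sigma, mem_filter, mem_Ioc, Nat.mem_primeFactors]
        have hpos : 0 < x.1 * x.2 := Nat.mul_pos h2 h6.pos
        exact ⟨⟨⟨hpos, by linarith⟩, PrimeFactorsIn.mul_iff.2
          ⟨h4, (primeFactorsIn_prime_iff h6).2 h7⟩⟩, h6, Dvd.intro_left _ rfl, hpos.ne'⟩
      · intro x _ _; positivity

theorem mem_SOS_of_primeFactorsIn {n : ℕ} (h : PrimeFactorsIn (fun p => p % 4 = 1) n) :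
    n ∈ SOS := by
  obtain ⟨x, y, hxy⟩ := (Nat.eq_sq_add_sq_iff (n := n)).2 fun q hq hq3 => by
    have := h q (Nat.prime_of_mem_primeFactors hq) (Nat.dvd_of_mem_primeFactors hq)
    omega
  exact ⟨x, y, by exact_mod_cast hxy⟩

/-- There are at least `c N / √(log N)` sums of two squares up to `N`. -/
theorem exists_le_card_SOS : ∃ c > 0, ∃ N₀ : ℕ, ∀ N, N₀ ≤ N →
    c * N / √(Real.log N) ≤ #{n ∈ Ioc 0 N | n ∈ SOS} := by
  obtain ⟨K, hK, h₁⟩ := exists_le_sum_log_one_mod_four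
  obtain ⟨c, hc, h₂⟩ := exists_sqrt_log_le_sum_one_mod_four
  have hK0 : (0 : ℝ) < K := by exact_mod_cast hK
  refine ⟨c / (4 * K), by positivity, (2 * K) ^ 2 + 2, fun N hN => ?_⟩
  have hN0 : (0 : ℝ) < N := by exact_mod_cast (by omega : 0 < N)
  have hlogN : 0 < Real.log N := Real.log_pos (by exact_mod_cast (by omega : 1 < N))
  have hM : 2 * K ≤ N / K := by
    rw [Nat.le_div_iff_mul_le hK]; nlinarith
  have hM2 : Real.log N / 4 ≤ Real.log (N / K : ℕ) := by
    have h3 : N ≤ (N / K) ^ 2 := by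
      have h4 := Nat.lt_div_mul_add hK (a := N)
      nlinarith
    have h5 : Real.log N ≤ 2 * Real.log (N / K : ℕ) := by
      rw [show (2 : ℝ) = (2 : ℕ) by norm_num, ← Real.log_pow]
      exact Real.log_le_log hN0 (by exact_mod_cast h3)
    linarith
  have h3 := h₂ (N / K) (by omega)
  have h4 : ∑ m ∈ Ioc 0 N with PrimeFactorsIn (fun p => p % 4 = 1) m,
      ∑ p ∈ Ioc 0 (N / m) with p.Prime ∧ p % 4 = 1, Real.log p ≤
        #{n ∈ Ioc 0 N | PrimeFactorsIn (fun p => p % 4 = 1) n} * Real.log N := by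
    convert sum_sum_log_le_card_mul_log (fun p => p % 4 = 1) N
  have h5 : ∑ m ∈ Ioc 0 (N / K) with PrimeFactorsIn (fun p => p % 4 = 1) m,
      N / (2 * K) * (1 / (m : ℝ)) ≤
      ∑ m ∈ Ioc 0 N with PrimeFactorsIn (fun p => p % 4 = 1) m,
        ∑ p ∈ Ioc 0 (N / m) with p.Prime ∧ p % 4 = 1, Real.log p := by
    refine (sum_le_sum fun m hm => ?_).trans
      (sum_le_sum_of_subset_of_nonneg ?_ fun m _ _ => sum_nonneg fun p _ => by positivity)
    · rw [mem_filter, mem_Ioc] at hm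
      have hm0 : (0 : ℝ) < m := by exact_mod_cast hm.1.1
      have hKm : K ≤ N / m := by
        rw [Nat.le_div_iff_mul_le hm.1.1]
        have := (Nat.le_div_iff_mul_le hK).1 hm.1.2
        linarith
      refine le_trans ?_ (h₁ (N / m) hKm)
      have h6 : (N : ℝ) ≤ 2 * m * (N / m : ℕ) := by
        have h7 := (Nat.lt_div_mul_add hm.1.1 (a := N)).le
        have h8 : m * 1 ≤ m * (N / m) := Nat.mul_le_mul_left _ (hK.trans hKm)
        have h9 : N ≤ 2 * m * (N / m) := by nlinarith
        exact_mod_cast h9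
      rw [div_mul_div_comm, div_le_div_iff₀ (by positivity) hK0]
      nlinarith
    · intro m hm
      rw [mem_filter, mem_Ioc] at *
      exact ⟨⟨hm.1.1, hm.1.2.trans (Nat.div_le_self _ _)⟩, hm.2⟩
  rw [← mul_sum] at h5
  have h6 : (#{n ∈ Ioc 0 N | PrimeFactorsIn (fun p => p % 4 = 1) n} : ℝ) ≤
      #{n ∈ Ioc 0 N | n ∈ SOS} := by
    exact_mod_cast card_le_card (monotone_filter_right _ fun n _ => mem_SOS_of_primeFactorsIn)
  have h7 : √(Real.log N) / 2 ≤ √(Real.log (N / K : ℕ)) := by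
    apply Real.le_sqrt_of_sq_le
    rw [div_pow, Real.sq_sqrt hlogN.le]
    linarith
  have h8 : N / (2 * K) * (c * (√(Real.log N) / 2)) ≤
      #{n ∈ Ioc 0 N | n ∈ SOS} * Real.log N := by
    calc _ ≤ N / (2 * K) * (c * √(Real.log (N / K : ℕ))) := by gcongr
      _ ≤ _ := mul_le_mul_of_nonneg_left h3 (by positivity)
      _ ≤ _ := h5
      _ ≤ _ := h4
      _ ≤ _ := by gcongr
  have hs : 0 < √(Real.log N) := Real.sqrt_pos.2 hlogN
  rw [div_le_iff₀ hs]
  have h9 : √(Real.log N) * √(Real.log N) = Real.log N := Real.mul_self_sqrt hlogN.le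
  refine le_of_mul_le_mul_right (le_trans (le_of_eq ?_) (h8.trans (le_of_eq ?_))) hs
  · field_simp
    ring
  · rw [mul_assoc, h9]

end LowerBound

section Representations

/-- The Gaussian integers of norm `n`. -/
def gaussNorm (n : ℕ) : Set GaussianInt := {z | z.norm = n}

theorem gaussNorm_def (z : GaussianInt) : z.norm = z.re ^ 2 + z.im ^ 2 := by
  rw [Zsqrtd.norm_def]; ring

theorem finite_gaussNorm (n : ℕ) : (gaussNorm n).Finite := by
  have h : Function.Injective fun z : GaussianInt => (z.re, z.im) := fun z w hzw => by
    rw [Prod.mk.injEq] at hzw; exact Zsqrtd.ext hzw.1 hzw.2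
  refine Set.Finite.of_finite_image (Set.Finite.subset
    (Set.finite_Icc ((-n, -n) : ℤ × ℤ) (n, n)) ?_) h.injOn
  rintro _ ⟨z, hz, rfl⟩
  have hz' : z.re ^ 2 + z.im ^ 2 = n := by rw [← gaussNorm_def]; exact hz
  have h1 : |z.re| ≤ n := by
    nlinarith [Int.natAbs_le_self_sq z.re, Int.natCast_natAbs z.re, sq_nonneg z.im]
  have h2 : |z.im| ≤ n := by
    nlinarith [Int.natAbs_le_self_sq z.im, Int.natCast_natAbs z.im, sq_nonneg z.re]
  rw [abs_le] at h1 h2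
  exact ⟨⟨h1.1, h2.1⟩, ⟨h1.2, h2.2⟩⟩

theorem r2_eq_ncard (n : ℕ) : r2 n = (gaussNorm n).ncard := by
  rw [← Nat.card_coe_set_eq, r2]
  refine Nat.card_congr ⟨fun p => ⟨⟨p.1.1, p.1.2⟩, ?_⟩, fun z => ⟨(z.1.re, z.1.im), ?_⟩,
    fun _ => rfl, fun _ => rfl⟩
  · exact (gaussNorm_def _).trans p.2
  · exact (gaussNorm_def _).symm.trans z.2

theorem r2_ne_zero_iff {n : ℕ} : r2 n ≠ 0 ↔ n ∈ SOS := by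
  rw [r2_eq_ncard, Ne, Set.ncard_eq_zero (finite_gaussNorm n), ← Ne,
    ← Set.nonempty_iff_ne_empty]
  constructor
  · rintro ⟨z, hz⟩
    exact ⟨z.re, z.im, by rw [← gaussNorm_def]; exact hz.symm⟩
  · rintro ⟨x, y, h⟩
    exact ⟨⟨x, y⟩, (gaussNorm_def _).trans h.symm⟩

theorem gaussNorm_mul {m n : ℕ} {z w : GaussianInt} (hz : z ∈ gaussNorm m) (hw : w ∈ gaussNorm n) :
    z * w ∈ gaussNorm (m * n) := by
  change (z * w).norm = _
  rw [Zsqrtd.norm_mul, show z.norm = m from hz, show w.norm = n from hw]; push_cast; rfl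

theorem gaussNorm_star {n : ℕ} {z : GaussianInt} (hz : z ∈ gaussNorm n) :
    star z ∈ gaussNorm n := (Zsqrtd.norm_conj z).trans hz

theorem mul_star_of_mem_gaussNorm {n : ℕ} {z : GaussianInt} (hz : z ∈ gaussNorm n) :
    z * star z = n := by
  rw [← Zsqrtd.norm_eq_mul_conj, show z.norm = n from hz]; push_cast; rfl

theorem r2_one : r2 1 = 4 := by
  rw [r2_eq_ncard]
  have : gaussNorm 1 = (({⟨1, 0⟩, ⟨-1, 0⟩, ⟨0, 1⟩, ⟨0, -1⟩} : Finset GaussianInt) :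
      Set GaussianInt) := by
    ext ⟨x, y⟩
    simp only [gaussNorm, Set.mem_ofPred_eq, gaussNorm_def, Finset.coe_insert,
      Finset.coe_singleton, Set.mem_insert_iff, Set.mem_singleton_iff, Zsqrtd.ext_iff]
    push_cast
    constructor
    · intro h
      have hx : x ^ 2 ≤ 1 := by nlinarith
      have hy : y ^ 2 ≤ 1 := by nlinarith
      rw [sq_le_one_iff_abs_le_one, abs_le] at hx hy
      obtain ⟨h1, h2⟩ := hx
      obtain ⟨h3, h4⟩ := hy
      interval_cases x <;> interval_cases y <;> simp_all
    · rintro (⟨rfl, rfl⟩ | ⟨rfl, rfl⟩ | ⟨rfl, rfl⟩ | ⟨rfl, rfl⟩) <;> norm_num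
  rw [this, Set.ncard_coe_finset]
  decide

theorem exists_mul_of_mem_gaussNorm {a b : ℕ} (ha : a ≠ 0) (hb : b ≠ 0) (hab : a.Coprime b)
    {t : GaussianInt} (ht : t ∈ gaussNorm (a * b)) :
    ∃ z ∈ gaussNorm a, ∃ w ∈ gaussNorm b, z * w = t := by
  have hd : t ∣ (a : GaussianInt) * b := by
    have := mul_star_of_mem_gaussNorm ht
    exact ⟨star t, by rw [this]; push_cast; rfl⟩
  obtain ⟨z, w, hz, hw, rfl⟩ := exists_dvd_and_dvd_of_dvd_mul hd
  have key : ∀ (c : ℕ) (z : GaussianInt), z ∣ (c : GaussianInt) → z.norm.natAbs ∣ c * c := by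
    rintro c z ⟨y, hy⟩
    have h1 : z.norm * y.norm = c * c := by
      rw [← Zsqrtd.norm_mul, ← hy, Zsqrtd.norm_natCast]
    exact_mod_cast Int.natAbs_dvd_natAbs.2 (Dvd.intro _ h1)
  have hn : z.norm.natAbs * w.norm.natAbs = a * b := by
    have h1 : (z * w).norm = (a * b : ℕ) := ht
    rw [← Int.natAbs_mul, ← Zsqrtd.norm_mul, h1, Int.natAbs_natCast]
  have h1 : z.norm.natAbs ∣ a :=
    (Nat.Coprime.coprime_dvd_left (key a z hz) (Nat.Coprime.mul_left hab hab)).dvd_of_dvd_mul_right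
      (Dvd.intro _ hn)
  have h2 : w.norm.natAbs ∣ b :=
    (Nat.Coprime.coprime_dvd_left (key b w hw)
      (Nat.Coprime.mul_left hab.symm hab.symm)).dvd_of_dvd_mul_left (Dvd.intro_left _ hn)
  have h3 := Nat.le_of_dvd ha.bot_lt h1
  have h4 := Nat.le_of_dvd hb.bot_lt h2
  have h5 : z.norm.natAbs = a := by
    by_contra h
    have : z.norm.natAbs < a := lt_of_le_of_ne h3 h
    nlinarith [hb.bot_lt, Nat.zero_le z.norm.natAbs]
  have h6 : w.norm.natAbs = b := by
    rw [h5] at hn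
    exact Nat.eq_of_mul_eq_mul_left ha.bot_lt hn
  refine ⟨z, ?_, w, ?_, rfl⟩
  · change z.norm = a
    rw [← h5, Int.natAbs_of_nonneg (Zsqrtd.norm_nonneg (by norm_num) z)]
  · change w.norm = b
    rw [← h6, Int.natAbs_of_nonneg (Zsqrtd.norm_nonneg (by norm_num) w)]

theorem exists_unit_of_mul_eq_mul {a b : ℕ} (ha : a ≠ 0) (hab : a.Coprime b)
    {z w z' w' : GaussianInt} (hz : z ∈ gaussNorm a) (hz' : z' ∈ gaussNorm a)
    (hw' : w' ∈ gaussNorm b) (h : z * w = z' * w') :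
    ∃ u ∈ gaussNorm 1, z' = u * z ∧ w' = star u * w := by
  have hco : IsCoprime z w' := by
    have h1 : IsCoprime ((a : ℤ) : GaussianInt) ((b : ℤ) : GaussianInt) :=
      (Nat.isCoprime_iff_coprime.2 hab).intCast
    push_cast at h1
    rw [← mul_star_of_mem_gaussNorm hz, ← mul_star_of_mem_gaussNorm hw'] at h1
    exact h1.of_mul_left_left.of_mul_right_left
  obtain ⟨u, hu⟩ := hco.dvd_of_dvd_mul_right (Dvd.intro w h)
  have hz0 : z ≠ 0 := by
    rintro rfl
    have h2 : (0 : GaussianInt).norm = a := hz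
    rw [Zsqrtd.norm_zero] at h2
    exact ha (by exact_mod_cast h2.symm)
  have hu1 : u ∈ gaussNorm 1 := by
    have h2 : z'.norm = a := hz'
    rw [hu, Zsqrtd.norm_mul, show z.norm = a from hz] at h2
    have h3 : (a : ℤ) ≠ 0 := by exact_mod_cast ha
    change u.norm = (1 : ℕ)
    push_cast
    exact mul_left_cancel₀ h3 (h2.trans (mul_one _).symm)
  have hus := mul_star_of_mem_gaussNorm hu1
  push_cast at hus
  refine ⟨u, hu1, by rw [hu, mul_comm], ?_⟩
  have h4 : w = u * w' := mul_left_cancel₀ hz0 (by rw [h, hu, mul_assoc])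
  rw [h4, ← mul_assoc, mul_comm (star u), hus, one_mul]

theorem r2_mul {a b : ℕ} (ha : a ≠ 0) (hb : b ≠ 0) (hab : a.Coprime b) :
    4 * r2 (a * b) = r2 a * r2 b := by
  rw [← r2_one]
  simp only [r2_eq_ncard, ← Nat.card_coe_set_eq, ← Nat.card_prod]
  choose! F hF G hG hFG using fun t (ht : t ∈ gaussNorm (a * b)) =>
    exists_mul_of_mem_gaussNorm ha hb hab ht
  have hus : ∀ u ∈ gaussNorm 1, u * star u = 1 := fun u hu => by
    rw [mul_star_of_mem_gaussNorm hu]; norm_num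
  have hm : ∀ u ∈ gaussNorm 1, ∀ t ∈ gaussNorm (a * b), (u * F t) * (star u * G t) = t := by
    intro u hu t ht
    rw [mul_mul_mul_comm, hus u hu, one_mul, hFG t ht]
  refine Nat.card_eq_of_bijective (fun x : gaussNorm 1 × gaussNorm (a * b) =>
    (⟨⟨x.1.1 * F x.2.1, ?_⟩, ⟨star x.1.1 * G x.2.1, ?_⟩⟩ : gaussNorm a × gaussNorm b)) ⟨?_, ?_⟩
  · simpa using gaussNorm_mul x.1.2 (hF _ x.2.2)
  · simpa using gaussNorm_mul (gaussNorm_star x.1.2) (hG _ x.2.2)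
  · rintro ⟨⟨u, hu⟩, ⟨t, ht⟩⟩ ⟨⟨v, hv⟩, ⟨s, hs⟩⟩ h
    simp only [Prod.mk.injEq, Subtype.mk.injEq] at h ⊢
    have hts : t = s := by rw [← hm u hu t ht, ← hm v hv s hs, h.1, h.2]
    subst hts
    refine ⟨mul_right_cancel₀ ?_ h.1, rfl⟩
    intro h0
    have h2 : (F t).norm = a := hF t ht
    rw [h0, Zsqrtd.norm_zero] at h2
    exact ha (by exact_mod_cast h2.symm)
  · rintro ⟨⟨z, hz⟩, ⟨w, hw⟩⟩
    have ht := gaussNorm_mul hz hw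
    obtain ⟨u, hu, h1, h2⟩ := exists_unit_of_mul_eq_mul ha hab (hF _ ht) hz hw (hFG _ ht)
    refine ⟨⟨⟨u, hu⟩, ⟨z * w, ht⟩⟩, ?_⟩
    simp only [Prod.mk.injEq, Subtype.mk.injEq]
    exact ⟨h1.symm, h2.symm⟩

theorem four_le_r2 {n : ℕ} (hn : n ≠ 0) (h : n ∈ SOS) : 4 ≤ r2 n := by
  have h1 := r2_ne_zero_iff.2 h
  rw [r2_eq_ncard, Ne, Set.ncard_eq_zero (finite_gaussNorm n), ← Ne,
    ← Set.nonempty_iff_ne_empty] at h1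
  obtain ⟨z, hz⟩ := h1
  rw [← r2_one, r2_eq_ncard, r2_eq_ncard]
  refine Set.ncard_le_ncard_of_injOn (fun u => u * z) (fun u hu => ?_) (fun u _ v _ huv => ?_)
    (finite_gaussNorm n)
  · simpa using gaussNorm_mul hu hz
  · refine mul_right_cancel₀ ?_ huv
    rintro rfl
    have h2 : (0 : GaussianInt).norm = n := hz
    rw [Zsqrtd.norm_zero] at h2
    exact hn (by exact_mod_cast h2.symm)

theorem mem_gaussNorm_one_of_isUnit {u : GaussianInt} (h : IsUnit u) : u ∈ gaussNorm 1 := by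
  have h1 := Zsqrtd.norm_eq_one_iff.2 h
  change u.norm = (1 : ℕ)
  rw [← h1, Int.natAbs_of_nonneg (Zsqrtd.norm_nonneg (by norm_num) u)]

theorem r2_le_of_forall_eq {n k : ℕ} (F : ℕ → GaussianInt)
    (h : ∀ t ∈ gaussNorm n, ∃ i ≤ k, Associated (F i) t) : r2 n ≤ 4 * (k + 1) := by
  rw [← r2_one, r2_eq_ncard, r2_eq_ncard]
  have hfin := (finite_gaussNorm 1).prod (Finset.range (k + 1)).finite_toSet
  have hsub : gaussNorm n ⊆ (fun x : GaussianInt × ℕ => F x.2 * x.1) ''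
      (gaussNorm 1 ×ˢ (Finset.range (k + 1) : Set ℕ)) := by
    intro t ht
    obtain ⟨i, hi, u, hu⟩ := h t ht
    exact ⟨(u, i), ⟨mem_gaussNorm_one_of_isUnit u.isUnit, by simp; omega⟩, hu⟩
  refine (Set.ncard_le_ncard hsub (hfin.image _)).trans ((Set.ncard_image_le hfin).trans ?_)
  rw [Set.ncard_prod, Set.ncard_coe_finset, Finset.card_range]

theorem prime_of_mem_gaussNorm {p : ℕ} (hp : p.Prime) {z : GaussianInt} (hz : z ∈ gaussNorm p) :
    Prime z := by
  rw [← irreducible_iff_prime]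
  have hz' : z.norm = p := hz
  constructor
  · intro h
    have h1 := Zsqrtd.norm_eq_one_iff.2 h
    rw [hz', Int.natAbs_natCast] at h1
    exact hp.one_lt.ne' h1
  · intro a b hab
    rw [← Zsqrtd.norm_eq_one_iff, ← Zsqrtd.norm_eq_one_iff]
    have h1 : a.norm.natAbs * b.norm.natAbs = p := by
      rw [← Int.natAbs_mul, ← Zsqrtd.norm_mul, ← hab, hz', Int.natAbs_natCast]
    rcases (Nat.dvd_prime hp).1 (Dvd.intro _ h1) with h | h
    · exact Or.inl h
    · right
      rw [h] at h1
      exact Nat.eq_of_mul_eq_mul_left hp.pos (h1.trans (mul_one p).symm)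

theorem r2_prime_pow_le {p : ℕ} (hp : p.Prime) (k : ℕ) : r2 (p ^ k) ≤ 4 * (k + 1) := by
  have := Fact.mk hp
  have hdvd : ∀ t ∈ gaussNorm (p ^ k), t ∣ (p : GaussianInt) ^ k := fun t ht =>
    ⟨star t, by rw [mul_star_of_mem_gaussNorm ht]; push_cast; rfl⟩
  by_cases h3 : p % 4 = 3
  · refine r2_le_of_forall_eq (fun i => (p : GaussianInt) ^ i) fun t ht => ?_
    obtain ⟨i, hi, h⟩ := (dvd_prime_pow
      (GaussianInt.prime_of_nat_prime_of_mod_four_eq_three p h3) k).1 (hdvd t ht)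
    exact ⟨i, hi, h.symm⟩
  · obtain ⟨x, y, hxy⟩ := Nat.Prime.sq_add_sq h3
    have hxy' : (x : ℤ) ^ 2 + (y : ℤ) ^ 2 = p := by exact_mod_cast hxy
    have hz : (⟨x, y⟩ : GaussianInt) ∈ gaussNorm p := (gaussNorm_def _).trans hxy'
    set z : GaussianInt := ⟨x, y⟩
    refine r2_le_of_forall_eq (fun i => z ^ i * star z ^ (k - i)) fun t ht => ?_
    have h1 := hdvd t ht
    rw [← mul_star_of_mem_gaussNorm hz, mul_pow] at h1
    obtain ⟨a, b, ha, hb, rfl⟩ := exists_dvd_and_dvd_of_dvd_mul h1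
    obtain ⟨i, hi, hai⟩ := (dvd_prime_pow (prime_of_mem_gaussNorm hp hz) k).1 ha
    obtain ⟨j, hj, hbj⟩ :=
      (dvd_prime_pow (prime_of_mem_gaussNorm hp (gaussNorm_star hz)) k).1 hb
    have hij := hai.mul_mul hbj
    obtain ⟨u, hu⟩ := id hij
    have h2 : (a * b).norm = (p ^ k : ℕ) := ht
    have h3 := congrArg Zsqrtd.norm hu
    have hpow : ∀ (w : GaussianInt) (n : ℕ), (w ^ n).norm = w.norm ^ n := fun w n => by
      exact map_pow Zsqrtd.normMonoidHom w n
    rw [Zsqrtd.norm_mul, h2, Zsqrtd.norm_mul, hpow, hpow, show z.norm = p from hz,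
      show (star z).norm = p from gaussNorm_star hz,
      show (u : GaussianInt).norm = (1 : ℕ) from mem_gaussNorm_one_of_isUnit u.isUnit,
      ← pow_add] at h3
    push_cast at h3
    rw [mul_one] at h3
    have h4 : p ^ k = p ^ (i + j) := by exact_mod_cast h3
    have h5 := Nat.pow_right_injective hp.two_le h4
    refine ⟨i, hi, ?_⟩
    rw [show k - i = j by omega]
    exact hij.symm

theorem r2_eq_zero_of_mod_four {n : ℕ} (h : n % 4 = 3) : r2 n = 0 := by
  by_contra h0
  obtain ⟨x, y, hxy⟩ := r2_ne_zero_iff.1 h0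
  have h1 : (x ^ 2 + y ^ 2) % 4 = 3 := by omega
  have h2 : x % 4 = 0 ∨ x % 4 = 1 ∨ x % 4 = 2 ∨ x % 4 = 3 := by omega
  have h3 : y % 4 = 0 ∨ y % 4 = 1 ∨ y % 4 = 2 ∨ y % 4 = 3 := by omega
  rcases h2 with h2 | h2 | h2 | h2 <;> rcases h3 with h3 | h3 | h3 | h3 <;>
    simp [pow_two, Int.add_emod, Int.mul_emod, h2, h3] at h1

theorem r2_prime_of_mod_four {p : ℕ} (hp : p.Prime) (h : p % 4 = 1) : r2 p = 8 := by
  have := Fact.mk hp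
  apply le_antisymm
  · simpa using r2_prime_pow_le hp 1
  obtain ⟨x, y, hxy⟩ := Nat.Prime.sq_add_sq (p := p) (by omega)
  have hx : x ≠ 0 := by
    rintro rfl
    exact hp.not_isSquare ⟨y, by rw [← hxy]; ring⟩
  have hy : y ≠ 0 := by
    rintro rfl
    exact hp.not_isSquare ⟨x, by rw [← hxy]; ring⟩
  have hne : x ≠ y := by
    rintro rfl
    omega
  have hxy' : (x : ℤ) ^ 2 + (y : ℤ) ^ 2 = p := by exact_mod_cast hxy
  have hsub : (({⟨x, y⟩, ⟨x, -y⟩, ⟨-x, y⟩, ⟨-x, -y⟩, ⟨y, x⟩, ⟨y, -x⟩, ⟨-y, x⟩, ⟨-y, -x⟩} :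
      Finset GaussianInt) : Set GaussianInt) ⊆ gaussNorm p := by
    intro z hz
    simp only [Finset.coe_insert, Finset.coe_singleton, Set.mem_insert_iff,
      Set.mem_singleton_iff] at hz
    rcases hz with rfl | rfl | rfl | rfl | rfl | rfl | rfl | rfl <;>
      exact (gaussNorm_def _).trans (by simpa [add_comm] using hxy')
  rw [r2_eq_ncard]
  refine le_trans (le_of_eq ?_) (Set.ncard_le_ncard hsub (finite_gaussNorm p))
  rw [Set.ncard_coe_finset]
  have e : ∀ a b c d : ℤ, ((⟨a, b⟩ : GaussianInt) = ⟨c, d⟩) ↔ a = c ∧ b = d := fun a b c d =>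
    Zsqrtd.ext_iff
  symm
  repeat rw [Finset.card_insert_of_notMem (by
    simp only [Finset.mem_insert, Finset.mem_singleton, e]; omega)]
  rw [Finset.card_singleton]

end Representations

section NormalOrder

open Finset
open scoped Classical

/-- The power `(r₂(n)/4)^s`, extended by zero to the `n` that are not sums of two squares. -/
def repPow (s : ℝ) (n : ℕ) : ℝ := if r2 n = 0 then 0 else ((r2 n : ℝ) / 4) ^ s

theorem one_le_r2_div_four {n : ℕ} (hn : n ≠ 0) (h : r2 n ≠ 0) : 1 ≤ (r2 n : ℝ) / 4 := by
  have h1 := four_le_r2 hn (r2_ne_zero_iff.1 h)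
  rw [le_div_iff₀ (by norm_num)]
  exact_mod_cast (by omega : 1 * 4 ≤ r2 n)

theorem repPow_nonneg (s : ℝ) (n : ℕ) : 0 ≤ repPow s n := by
  rw [repPow]; split_ifs <;> positivity

theorem isDivisorBounded_repPow {s : ℝ} (hs : s ≤ 1) : IsDivisorBounded (repPow s) where
  one := by simp [repPow, r2_one]
  mul {m n} hmn := by
    rcases Nat.eq_zero_or_pos m with rfl | hm
    · rw [Nat.coprime_zero_left] at hmn
      subst hmn
      simp [repPow, r2_one]
    rcases Nat.eq_zero_or_pos n with rfl | hn
    · rw [Nat.coprime_zero_right] at hmn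
      subst hmn
      simp [repPow, r2_one]
    have h1 := r2_mul hm.ne' hn.ne' hmn
    by_cases h2 : r2 m = 0
    · have : r2 (m * n) = 0 := by simpa [h2] using h1
      simp [repPow, h2, this]
    by_cases h3 : r2 n = 0
    · have : r2 (m * n) = 0 := by simpa [h3] using h1
      simp [repPow, h3, this]
    have h4 : r2 (m * n) ≠ 0 := by
      intro h
      rw [h, mul_zero] at h1
      exact mul_ne_zero h2 h3 h1.symm
    have h5 : (4 : ℝ) * r2 (m * n) = r2 m * r2 n := by exact_mod_cast h1
    rw [repPow, repPow, repPow, if_neg h2, if_neg h3, if_neg h4,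
      ← Real.mul_rpow (by positivity) (by positivity)]
    congr 1
    linarith
  nonneg := repPow_nonneg s
  le {p} k hp := by
    rw [repPow]
    split_ifs with h
    · positivity
    · refine (Real.rpow_le_rpow_of_exponent_le
        (one_le_r2_div_four (pow_ne_zero k hp.ne_zero) h) hs).trans ?_
      rw [Real.rpow_one, div_le_iff₀ (by norm_num)]
      have := r2_prime_pow_le hp k
      have h2 : (r2 (p ^ k) : ℝ) ≤ 4 * (k + 1) := by exact_mod_cast this
      linarith

theorem exists_sum_repPow_le {s : ℝ} (hs : s ≤ 1) : ∃ C > 0, ∀ N : ℕ, 2 ≤ N →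
    ∑ n ∈ Ioc 0 N, repPow s n ≤ C * N * Real.log N ^ ((2 : ℝ) ^ s / 2 - 1) := by
  obtain ⟨C₁, hC₁, h₁⟩ := exists_sum_mul_log_le_exp
  obtain ⟨C₂, h₂⟩ := exists_sum_prime_inv_le (fun n => n % 4 = 1)
    exists_abs_sum_log_div_one_mod_four_le
  have hf := isDivisorBounded_repPow hs
  refine ⟨C₁ * Real.exp ((2 : ℝ) ^ s * C₂ + 1), by positivity, fun N hN => ?_⟩
  have hlog : 0 < Real.log N := Real.log_pos (by exact_mod_cast (by omega : 1 < N))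
  have h3 := h₁ _ hf N
  have h4 : ∑ p ∈ Ioc 0 N with p.Prime, repPow s p / p ≤
      (2 : ℝ) ^ s * ∑ p ∈ Ioc 0 N with p.Prime ∧ p % 4 = 1, 1 / (p : ℝ) + 1 := by
    calc _ ≤ ∑ p ∈ Ioc 0 N, ((2 : ℝ) ^ s * (if p.Prime ∧ p % 4 = 1 then 1 / (p : ℝ) else 0) +
          if p = 2 then 1 else 0) := by
          rw [sum_filter]
          refine sum_le_sum fun p _ => ?_
          by_cases hp : p.Prime
          · rcases hp.eq_two_or_odd with rfl | hodd
            · have h5 := hf.le 1 Nat.prime_two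
              norm_num at h5 ⊢
              linarith
            · have hp2 : p ≠ 2 := by rintro rfl; omega
              rcases (by omega : p % 4 = 1 ∨ p % 4 = 3) with h | h
              · simp only [hp, h, hp2, repPow, r2_prime_of_mod_four hp h]
                norm_num
                rw [div_eq_mul_inv]
              · simp [hp, h, hp2, repPow, r2_eq_zero_of_mod_four h]
          · have hp2 : p ≠ 2 := by rintro rfl; exact hp Nat.prime_two
            simp [hp, hp2]
      _ ≤ _ := by
          rw [sum_add_distrib, ← mul_sum, sum_filter]
          gcongr
          rw [sum_ite_eq']
          split_ifs <;> norm_num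
  have h5 : Real.exp (∑ p ∈ Ioc 0 N with p.Prime, repPow s p / p) ≤
      Real.log N ^ ((2 : ℝ) ^ s / 2) * Real.exp ((2 : ℝ) ^ s * C₂ + 1) := by
    rw [Real.rpow_def_of_pos hlog, ← Real.exp_add]
    apply Real.exp_le_exp.2
    refine h4.trans ?_
    have := mul_le_mul_of_nonneg_left (h₂ N hN) (by positivity : 0 ≤ (2 : ℝ) ^ s)
    linarith
  rw [Real.rpow_sub hlog, Real.rpow_one, mul_div_assoc', le_div_iff₀ hlog]
  refine h3.trans ?_
  calc _ ≤ C₁ * N * (Real.log N ^ ((2 : ℝ) ^ s / 2) * Real.exp ((2 : ℝ) ^ s * C₂ + 1)) := by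
        gcongr
    _ = _ := by ring

theorem exists_sum_r2_le : ∃ C > 0, ∀ N : ℕ, 2 ≤ N → ∑ n ∈ Ioc 0 N, (r2 n : ℝ) ≤ C * N := by
  obtain ⟨C, hC, h⟩ := exists_sum_repPow_le (le_refl (1 : ℝ))
  refine ⟨4 * C, by positivity, fun N hN => ?_⟩
  have h1 := h N hN
  norm_num at h1
  have h2 : ∑ n ∈ Ioc 0 N, (r2 n : ℝ) = 4 * ∑ n ∈ Ioc 0 N, repPow 1 n := by
    rw [mul_sum]
    refine sum_congr rfl fun n _ => ?_
    rw [repPow]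
    split_ifs with h0
    · simp [h0]
    · rw [Real.rpow_one]; ring
  rw [h2]
  linarith

theorem two_rpow_neg_abs_mul_rpow_le {L l a : ℝ} (hL : 0 < L) (h1 : L / 2 ≤ l) (h2 : l ≤ L) :
    (2 : ℝ) ^ (-|a|) * L ^ a ≤ l ^ a := by
  have hl : 0 < l := by linarith
  rcases le_total 0 a with ha | ha
  · rw [abs_of_nonneg ha, Real.rpow_neg (by norm_num), inv_mul_eq_div,
      ← Real.div_rpow hL.le (by norm_num)]
    exact Real.rpow_le_rpow (by positivity) h1 ha
  · have h3 := Real.rpow_le_rpow_of_nonpos hl h2 ha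
    refine le_trans ?_ h3
    have h4 : (2 : ℝ) ^ (-|a|) ≤ 1 :=
      Real.rpow_le_one_of_one_le_of_nonpos (by norm_num) (by linarith [abs_nonneg a])
    exact mul_le_of_le_one_left (by positivity) h4

theorem exists_card_large_rep_le {s a : ℝ} (hs : s ≤ 1) : ∃ C > 0, ∀ N : ℕ, 2 ≤ N →
    (#{n ∈ Ioc 0 N | n ∈ SOS ∧
      a * Real.log (Real.log n) ≤ s * Real.log ((r2 n : ℝ) / 4)} : ℝ) ≤
      √N + C * N * Real.log N ^ ((2 : ℝ) ^ s / 2 - 1 - a) := by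
  obtain ⟨C, hC, h⟩ := exists_sum_repPow_le hs
  refine ⟨(2 : ℝ) ^ |a| * C, by positivity, fun N hN => ?_⟩
  set L := Real.log N with hLdef
  have hL : 0 < L := Real.log_pos (by exact_mod_cast (by omega : 1 < N))
  set B := {n ∈ Ioc 0 N | n ∈ SOS ∧
      a * Real.log (Real.log n) ≤ s * Real.log ((r2 n : ℝ) / 4)} with hB
  have hsub : B ⊆ Ioc 0 (Nat.sqrt N) ∪ {n ∈ B | Nat.sqrt N < n} := by
    intro n hn
    have hn' := hn
    rw [hB, mem_filter, mem_Ioc] at hn'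
    rw [mem_union, mem_Ioc, mem_filter]
    rcases le_or_gt n (Nat.sqrt N) with h1 | h1
    · exact Or.inl ⟨hn'.1.1, h1⟩
    · exact Or.inr ⟨hn, h1⟩
  have h1 : (#B : ℝ) ≤ √N + #{n ∈ B | Nat.sqrt N < n} := by
    have h2 := (card_le_card hsub).trans (card_union_le _ _)
    rw [Nat.card_Ioc, Nat.sub_zero] at h2
    calc (#B : ℝ) ≤ (Nat.sqrt N : ℝ) + #{n ∈ B | Nat.sqrt N < n} := by exact_mod_cast h2
      _ ≤ _ := by gcongr; exact Real.nat_sqrt_le_real_sqrt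
  refine h1.trans ?_
  gcongr
  have h3 : (#{n ∈ B | Nat.sqrt N < n} : ℝ) * ((2 : ℝ) ^ (-|a|) * L ^ a) ≤
      ∑ n ∈ Ioc 0 N, repPow s n := by
    rw [← nsmul_eq_mul]
    refine (card_nsmul_le_sum _ _ _ fun n hn => ?_).trans
      (sum_le_sum_of_subset_of_nonneg (fun n hn => ?_) fun n _ _ => repPow_nonneg s n)
    · rw [hB, mem_filter, mem_filter, mem_Ioc] at hn
      obtain ⟨⟨⟨h4, h5⟩, h6, h7⟩, h8⟩ := hn
      have hn0 : (0 : ℝ) < n := by exact_mod_cast h4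
      have h9 : L / 2 ≤ Real.log n := by
        have h10 : N ≤ n ^ 2 := by
          have := Nat.sqrt_lt'.1 h8
          omega
        have h11 : L ≤ 2 * Real.log n := by
          rw [show (2 : ℝ) = (2 : ℕ) by norm_num, ← Real.log_pow]
          exact Real.log_le_log (by exact_mod_cast (by omega : 0 < N)) (by exact_mod_cast h10)
        linarith
      have h10 : Real.log n ≤ L := Real.log_le_log hn0 (by exact_mod_cast h5)
      refine (two_rpow_neg_abs_mul_rpow_le hL h9 h10).trans ?_
      have hr := r2_ne_zero_iff.2 h6
      rw [repPow, if_neg hr, Real.rpow_def_of_pos (by linarith),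
        Real.rpow_def_of_pos (by linarith [one_le_r2_div_four h4.ne' hr])]
      exact Real.exp_le_exp.2 (by linarith)
    · exact (mem_filter.1 (mem_filter.1 hn).1).1
  have h4 := h3.trans (h N hN)
  have h5 : (0 : ℝ) < 2 ^ |a| := by positivity
  have h6 : 0 < L ^ a := by positivity
  rw [Real.rpow_neg (by norm_num), inv_mul_eq_div, mul_div_assoc', div_le_iff₀ h5,
    ← le_div_iff₀ h6] at h4
  refine h4.trans (le_of_eq ?_)
  rw [Real.rpow_sub hL _ a]
  ring

theorem tendsto_log_natCast : Tendsto (fun N : ℕ => Real.log N) atTop atTop :=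
  Real.tendsto_log_atTop.comp tendsto_natCast_atTop_atTop

theorem tendsto_card_large_rep {s a : ℝ} (hs : s ≤ 1) (hsa : (2 : ℝ) ^ s / 2 - 1 / 2 < a) :
    Tendsto (fun N : ℕ => (#{n ∈ Ioc 0 N | n ∈ SOS ∧
      a * Real.log (Real.log n) ≤ s * Real.log ((r2 n : ℝ) / 4)} : ℝ) * (√(Real.log N) / N))
      atTop (𝓝 0) := by
  obtain ⟨C, hC, h⟩ := exists_card_large_rep_le (a := a) hs
  have h1 : Tendsto (fun N : ℕ => √(Real.log N / N) +
      C * Real.log N ^ (-(a - ((2 : ℝ) ^ s / 2 - 1 / 2)))) atTop (𝓝 0) := by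
    have h2 : Tendsto (fun x : ℝ => Real.log x / x) atTop (𝓝 0) :=
      Real.isLittleO_log_id_atTop.tendsto_div_nhds_zero
    have h3 := (h2.comp tendsto_natCast_atTop_atTop).sqrt
    have h4 := ((tendsto_rpow_neg_atTop (sub_pos.2 hsa)).comp tendsto_log_natCast).const_mul C
    simpa using h3.add h4
  refine squeeze_zero' (Eventually.of_forall fun N => by positivity) ?_ h1
  filter_upwards [eventually_ge_atTop 2] with N hN
  have hN0 : (0 : ℝ) < N := by exact_mod_cast (by omega : 0 < N)
  have hL : 0 < Real.log N := Real.log_pos (by exact_mod_cast (by omega : 1 < N))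
  refine (mul_le_mul_of_nonneg_right (h N hN) (by positivity)).trans (le_of_eq ?_)
  rw [add_mul]
  congr 1
  · rw [Real.sqrt_div hL.le]
    have h2 : √(N : ℝ) ^ 2 = N := Real.sq_sqrt hN0.le
    have h3 : 0 < √(N : ℝ) := Real.sqrt_pos.2 hN0
    rw [mul_div_assoc', div_eq_div_iff hN0.ne' h3.ne']
    linear_combination √(Real.log N) * h2
  · rw [show -(a - ((2 : ℝ) ^ s / 2 - 1 / 2)) = ((2 : ℝ) ^ s / 2 - 1 - a) + 1 / 2 by ring,
      Real.rpow_add hL, Real.sqrt_eq_rpow]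
    field_simp

/-- The normal order of `log r₂` along the sums of two squares is `½ log 2 · log log n`. -/
theorem tendsto_card_abnormal {ε : ℝ} (hε : 0 < ε) :
    Tendsto (fun N : ℕ => (#{n ∈ Ioc 0 N | n ∈ SOS ∧ ε * Real.log (Real.log n) ≤
      |Real.log ((r2 n : ℝ) / 4) - 1 / 2 * Real.log 2 * Real.log (Real.log n)|} : ℝ) *
        (√(Real.log N) / N)) atTop (𝓝 0) := by
  set δ := min ε 1 with hδ
  have hδ0 : 0 < δ := by positivity
  have hδε : δ ≤ ε := min_le_left _ _
  have hδ1 : δ ≤ 1 := min_le_right _ _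
  have hlog2 : 0 < Real.log 2 := Real.log_pos (by norm_num)
  have hlog2' : Real.log 2 < 1 := by linarith [Real.log_two_lt_d9]
  have key : ∀ s : ℝ, |s| = δ →
      (2 : ℝ) ^ s / 2 - 1 / 2 < s * (1 / 2 * Real.log 2) + δ * ε := by
    intro s hs
    have h1 : |Real.log 2 * s| ≤ 1 := by
      rw [abs_mul, hs, abs_of_pos hlog2]; nlinarith
    have h2 := (abs_le.1 (Real.abs_exp_sub_one_sub_id_le h1)).2
    rw [Real.rpow_def_of_pos (by norm_num)]
    have h3 : (Real.log 2 * s) ^ 2 ≤ δ ^ 2 := by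
      rw [← sq_abs, abs_mul, hs, abs_of_pos hlog2]
      gcongr
      nlinarith
    nlinarith [mul_pos hδ0 hδ0, mul_le_mul_of_nonneg_left hδε hδ0.le]
  have h1 := tendsto_card_large_rep hδ1 (key δ (abs_of_pos hδ0))
  have h2 := tendsto_card_large_rep (by linarith : -δ ≤ 1) (key (-δ) (by
    rw [abs_neg, abs_of_pos hδ0]))
  have h3 := h1.add h2
  rw [add_zero] at h3
  refine squeeze_zero (fun N => by positivity) (fun N => ?_) h3
  rw [← add_mul]
  gcongr
  norm_cast
  refine le_trans (card_le_card ?_) (card_union_le _ _)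
  intro n hn
  rw [mem_union, mem_filter, mem_filter]
  rw [mem_filter] at hn
  obtain ⟨hn1, hn2, hn3⟩ := hn
  rcases le_abs.1 hn3 with h | h
  · exact Or.inl ⟨hn1, hn2, by nlinarith [mul_le_mul_of_nonneg_left h hδ0.le]⟩
  · exact Or.inr ⟨hn1, hn2, by nlinarith [mul_le_mul_of_nonneg_left h hδ0.le]⟩

end NormalOrder

section Tail

open Finset
open scoped Classical

theorem r2_le_sqrt (n : ℕ) : r2 n ≤ 2 * (2 * Nat.sqrt n + 1) := by
  rw [r2_eq_ncard]
  set T : Finset (ℤ × Bool) := Icc (-(Nat.sqrt n : ℤ)) (Nat.sqrt n) ×ˢ univ with hT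
  have h1 : (gaussNorm n).ncard ≤ (T : Set (ℤ × Bool)).ncard := by
    refine Set.ncard_le_ncard_of_injOn (fun z => (z.re, decide (0 ≤ z.im))) (fun z hz => ?_)
      (fun z hz w hw hzw => ?_) T.finite_toSet
    · have hz' : z.re ^ 2 + z.im ^ 2 = n := by rw [← gaussNorm_def]; exact hz
      have h2 : z.re.natAbs ≤ Nat.sqrt n := by
        rw [Nat.le_sqrt']
        zify
        rw [sq_abs]
        nlinarith [sq_nonneg z.im]
      simp only [hT, coe_product, Set.mem_prod, coe_Icc, Set.mem_Icc, coe_univ, Set.mem_univ,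
        and_true]
      omega
    · have hz' : z.re ^ 2 + z.im ^ 2 = n := by rw [← gaussNorm_def]; exact hz
      have hw' : w.re ^ 2 + w.im ^ 2 = n := by rw [← gaussNorm_def]; exact hw
      simp only [Prod.mk.injEq, decide_eq_decide] at hzw
      have h2 : z.im ^ 2 = w.im ^ 2 := by rw [hzw.1] at hz'; linarith
      refine Zsqrtd.ext hzw.1 ?_
      rcases sq_eq_sq_iff_eq_or_eq_neg.1 h2 with h | h <;> omega
  refine h1.trans (le_of_eq ?_)
  rw [Set.ncard_coe_finset, hT, card_product, Int.card_Icc, card_univ, Fintype.card_bool]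
  omega

theorem summable_r2_div_sq : Summable fun n : ℕ => (r2 n : ℝ) / (n : ℝ) ^ 2 := by
  have h1 : Summable fun n : ℕ => 6 * (1 / (n : ℝ) ^ (3 / 2 : ℝ)) :=
    (Real.summable_one_div_nat_rpow.2 (by norm_num)).mul_left 6
  refine Summable.of_nonneg_of_le (fun n => by positivity) (fun n => ?_) h1
  rcases Nat.eq_zero_or_pos n with rfl | hn
  · simp
  have hn0 : (0 : ℝ) < n := by exact_mod_cast hn
  have h2 : (r2 n : ℝ) ≤ 2 * (2 * Nat.sqrt n + 1) := by exact_mod_cast r2_le_sqrt n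
  have h3 : (Nat.sqrt n : ℝ) ≤ √n := Real.nat_sqrt_le_real_sqrt
  have h4 : 1 ≤ √(n : ℝ) := Real.one_le_sqrt.2 (by exact_mod_cast hn)
  have h5 : (n : ℝ) ^ (3 / 2 : ℝ) * √n = (n : ℝ) ^ 2 := by
    rw [Real.sqrt_eq_rpow, ← Real.rpow_add hn0, ← Real.rpow_natCast]; norm_num
  rw [← h5, mul_one_div, div_le_div_iff₀ (by positivity) (by positivity)]
  have h6 : (r2 n : ℝ) ≤ 6 * √n := by linarith
  have h7 : 0 < (n : ℝ) ^ (3 / 2 : ℝ) := by positivity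
  nlinarith

/-- The sum of `r₂(n)/(n - m)²` over `n ≠ m` (the term `n = m` is `0`). -/
def tailSum (m : ℕ) : ℝ := ∑' n : ℕ, (r2 n : ℝ) / ((n : ℝ) - m) ^ 2

theorem r2_div_sq_sub_le {m n N : ℕ} (hm : m ≤ N) (hn : 2 * N + 1 ≤ n) :
    (r2 n : ℝ) / ((n : ℝ) - m) ^ 2 ≤ 4 * ((r2 n : ℝ) / (n : ℝ) ^ 2) := by
  have h1 : (2 : ℝ) * m + 1 ≤ n := by exact_mod_cast (by omega : 2 * m + 1 ≤ n)
  have h2 : (0 : ℝ) ≤ m := by positivity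
  have h3 : (0 : ℝ) < (n : ℝ) - m := by linarith
  rw [mul_div_assoc', div_le_div_iff₀ (by positivity) (by nlinarith)]
  have h4 : (n : ℝ) ^ 2 ≤ 4 * ((n : ℝ) - m) ^ 2 := by nlinarith
  have h5 : (0 : ℝ) ≤ r2 n := by positivity
  nlinarith

theorem summable_r2_div_sq_sub (m : ℕ) :
    Summable fun n : ℕ => (r2 n : ℝ) / ((n : ℝ) - m) ^ 2 := by
  refine Summable.of_norm_bounded_eventually_nat (summable_r2_div_sq.mul_left 4) ?_
  filter_upwards [eventually_ge_atTop (2 * m + 1)] with n hn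
  rw [Real.norm_of_nonneg (by positivity)]
  exact r2_div_sq_sub_le le_rfl hn

theorem tailSum_nonneg (m : ℕ) : 0 ≤ tailSum m := tsum_nonneg fun n => by positivity

theorem tailSum_le {m N : ℕ} (hm : m ≤ N) :
    tailSum m ≤ ∑ n ∈ range (2 * N + 1), (r2 n : ℝ) / ((n : ℝ) - m) ^ 2 +
      4 * ∑' n : ℕ, (r2 n : ℝ) / (n : ℝ) ^ 2 := by
  have h1 : HasSum (fun n : ℕ => if n ∈ range (2 * N + 1) then
      (r2 n : ℝ) / ((n : ℝ) - m) ^ 2 else 0)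
      (∑ n ∈ range (2 * N + 1), (r2 n : ℝ) / ((n : ℝ) - m) ^ 2) := by
    rw [sum_congr rfl fun n hn => (if_pos hn).symm]
    exact hasSum_sum_of_ne_finset_zero fun n hn => if_neg hn
  refine hasSum_le (fun n => ?_) (summable_r2_div_sq_sub m).hasSum
    (h1.add (summable_r2_div_sq.hasSum.mul_left 4))
  split_ifs with hn
  · exact le_add_of_nonneg_right (by positivity)
  · rw [zero_add]
    rw [mem_range, not_lt] at hn
    exact r2_div_sq_sub_le hm hn

theorem sum_inv_sq_sub_le (n N : ℕ) :
    ∑ m ∈ Ioc 0 N, 1 / ((n : ℝ) - m) ^ 2 ≤ ∑' k : ℤ, 1 / (k : ℝ) ^ 2 := by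
  have hinj : Set.InjOn (fun m : ℕ => (n : ℤ) - m) (Ioc 0 N : Finset ℕ) := by
    intro x _ y _ h
    simp only at h
    omega
  have h1 := (Real.summable_one_div_int_pow.2 one_lt_two).sum_le_tsum
    ((Ioc 0 N).image fun m : ℕ => (n : ℤ) - m) fun k _ => by positivity
  rw [sum_image hinj] at h1
  simpa using h1

theorem exists_sum_tailSum_le : ∃ C > 0, ∀ N : ℕ, 2 ≤ N → ∑ m ∈ Ioc 0 N, tailSum m ≤ C * N := by
  obtain ⟨C, hC, h⟩ := exists_sum_r2_le
  set B := ∑' k : ℤ, 1 / (k : ℝ) ^ 2 with hB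
  set S := ∑' n : ℕ, (r2 n : ℝ) / (n : ℝ) ^ 2 with hS
  have hB0 : 0 ≤ B := tsum_nonneg fun k => by positivity
  have hS0 : 0 ≤ S := tsum_nonneg fun k => by positivity
  refine ⟨(r2 0 + 2 * C) * B + 4 * S + 1, by positivity, fun N hN => ?_⟩
  have hN1 : (1 : ℝ) ≤ N := by exact_mod_cast (by omega : 1 ≤ N)
  have h1 : ∑ n ∈ range (2 * N + 1), (r2 n : ℝ) ≤ (r2 0 + 2 * C) * N := by
    have h2 := h (2 * N) (by omega)
    have h3 : range (2 * N + 1) = insert 0 (Ioc 0 (2 * N)) := by ext; simp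
    rw [h3, sum_insert (by simp)]
    push_cast at h2
    have : (r2 0 : ℝ) ≤ r2 0 * N := le_mul_of_one_le_right (by positivity) hN1
    linarith
  calc _ ≤ ∑ m ∈ Ioc 0 N, (∑ n ∈ range (2 * N + 1), (r2 n : ℝ) / ((n : ℝ) - m) ^ 2 + 4 * S) :=
        sum_le_sum fun m hm => tailSum_le (mem_Ioc.1 hm).2
    _ = ∑ n ∈ range (2 * N + 1), (r2 n : ℝ) * ∑ m ∈ Ioc 0 N, 1 / ((n : ℝ) - m) ^ 2 +
          N * (4 * S) := by
        rw [sum_add_distrib, sum_comm, sum_const, Nat.card_Ioc, nsmul_eq_mul, Nat.sub_zero]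
        congr 1
        refine sum_congr rfl fun n _ => ?_
        rw [mul_sum]
        exact sum_congr rfl fun m _ => by rw [mul_one_div]
    _ ≤ ∑ n ∈ range (2 * N + 1), (r2 n : ℝ) * B + N * (4 * S) := by
        gcongr with n
        exact sum_inv_sq_sub_le n N
    _ ≤ (r2 0 + 2 * C) * N * B + N * (4 * S) := by
        rw [← sum_mul]
        gcongr
    _ ≤ _ := by nlinarith

theorem r2_le_mq_and_mq_le {q lam : ℝ} (hq : 1 ≤ q) {m : ℕ} (hΔ : 0 < |(m : ℝ) - lam|)
    (hmin : ∀ n ∈ SOS, |(m : ℝ) - lam| ≤ |(n : ℝ) - lam|) :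
    (r2 m : ℝ) ≤ mq q lam |(m : ℝ) - lam| ∧
      mq q lam |(m : ℝ) - lam| ≤ r2 m + 4 * |(m : ℝ) - lam| ^ 2 * tailSum m := by
  set Δ := |(m : ℝ) - lam| with hΔdef
  set F : ℕ → ℝ := fun n => Δ ^ (2 * q) * ((r2 n : ℝ) * |(n : ℝ) - lam| ^ (-(2 * q))) with hF
  have hmq : mq q lam Δ = ∑' n, F n := by rw [mq, hF, tsum_mul_left]
  have hF0 : ∀ n, 0 ≤ F n := fun n => by positivity
  have hFm : F m = r2 m := by
    rw [hF]
    simp only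
    rw [← hΔdef, Real.rpow_neg hΔ.le]
    have : Δ ^ (2 * q) ≠ 0 := (Real.rpow_pos_of_pos hΔ _).ne'
    field_simp
  have hle : ∀ n, F n ≤ (if n = m then (r2 m : ℝ) else 0) +
      4 * Δ ^ 2 * ((r2 n : ℝ) / ((n : ℝ) - m) ^ 2) := by
    intro n
    split_ifs with hnm
    · subst hnm; simp [hFm]
    rw [zero_add]
    by_cases h0 : r2 n = 0
    · simp [hF, h0]
    have h1 := hmin n (r2_ne_zero_iff.1 h0)
    have hpos : 0 < |(n : ℝ) - lam| := hΔ.trans_le h1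
    have hnm' : (n : ℝ) - m ≠ 0 := by rw [sub_ne_zero]; exact_mod_cast hnm
    have h2 : F n = r2 n * (Δ / |(n : ℝ) - lam|) ^ (2 * q) := by
      simp only [hF]
      rw [Real.div_rpow hΔ.le hpos.le, Real.rpow_neg hpos.le]
      ring
    have h3 : (Δ / |(n : ℝ) - lam|) ^ (2 * q) ≤ (Δ / |(n : ℝ) - lam|) ^ (2 : ℝ) :=
      Real.rpow_le_rpow_of_exponent_ge (by positivity) ((div_le_one hpos).2 h1) (by linarith)
    have h4 : |(n : ℝ) - m| ≤ 2 * |(n : ℝ) - lam| := by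
      have h5 := abs_sub_le (n : ℝ) lam m
      rw [abs_sub_comm lam] at h5
      linarith
    have h5 : ((n : ℝ) - m) ^ 2 ≤ 4 * |(n : ℝ) - lam| ^ 2 := by
      rw [← sq_abs ((n : ℝ) - m)]
      nlinarith [abs_nonneg ((n : ℝ) - m)]
    rw [h2]
    calc _ ≤ (r2 n : ℝ) * (Δ / |(n : ℝ) - lam|) ^ (2 : ℝ) := by gcongr
      _ = r2 n * (Δ ^ 2 / |(n : ℝ) - lam| ^ 2) := by
          rw [Real.rpow_two, div_pow]
      _ ≤ r2 n * (4 * Δ ^ 2 / ((n : ℝ) - m) ^ 2) := by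
          gcongr ?_ * ?_
          rw [div_le_div_iff₀ (by positivity) (by positivity)]
          nlinarith [sq_nonneg Δ]
      _ = _ := by ring
  have hsum := (hasSum_ite_eq m (r2 m : ℝ)).add
    ((summable_r2_div_sq_sub m).hasSum.mul_left (4 * Δ ^ 2))
  have hFs : Summable F := Summable.of_nonneg_of_le hF0 hle hsum.summable
  rw [hmq]
  exact ⟨by rw [← hFm]; exact hFs.le_tsum m fun n _ => hF0 n, hasSum_le hle hFs.hasSum hsum⟩

end Tail

section Density

open Finset
open scoped Classical

theorem fullDensityIdx_of_tendsto_card_compl {J : Set ℕ}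
    (h : Tendsto (fun k : ℕ => (#{j ∈ Icc 1 k | j ∉ J} : ℝ) / k) atTop (𝓝 0)) :
    FullDensityIdx J := by
  rw [FullDensityIdx]
  have h1 := h.const_sub 1
  rw [sub_zero] at h1
  refine h1.congr' ?_
  filter_upwards [eventually_ge_atTop 1] with k hk
  have hk0 : (k : ℝ) ≠ 0 := by exact_mod_cast (by omega : k ≠ 0)
  have h2 : Nat.card ↥(J ∩ Set.Icc 1 k) = #{j ∈ Icc 1 k | j ∈ J} := by
    rw [Nat.card_coe_set_eq, ← Set.ncard_coe_finset]
    congr 1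
    ext j
    rw [Set.mem_inter_iff, Set.mem_Icc, mem_coe, mem_filter, mem_Icc, and_comm]
  have h3 : #{j ∈ Icc 1 k | j ∈ J} + #{j ∈ Icc 1 k | j ∉ J} = k := by
    rw [card_filter_add_card_filter_not, Nat.card_Icc, Nat.add_sub_cancel]
  rw [h2, eq_div_iff hk0, sub_mul, div_mul_cancel₀ _ hk0, one_mul, sub_eq_iff_eq_add]
  exact_mod_cast h3.symm

/-- A function that is small outside sets of density zero tends to zero along a set of full
density. -/
theorem exists_fullDensityIdx_eventually_lt (φ : ℕ → ℝ)
    (h : ∀ ε > 0, Tendsto (fun k : ℕ => (#{j ∈ Icc 1 k | ε ≤ φ j} : ℝ) / k) atTop (𝓝 0)) :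
    ∃ J : Set ℕ, FullDensityIdx J ∧ ∀ ε > 0, ∀ᶠ j in atTop ⊓ 𝓟 J, φ j < ε := by
  have h1 : ∀ i : ℕ, ∃ K : ℕ, ∀ k ≥ K,
      (#{j ∈ Icc 1 k | 1 / ((i : ℝ) + 1) ≤ φ j} : ℝ) / k ≤ 1 / ((i : ℝ) + 1) := by
    intro i
    have hi : (0 : ℝ) < 1 / ((i : ℝ) + 1) := by positivity
    exact eventually_atTop.1 ((h _ hi).eventually_le_const hi)
  choose K hK using h1
  set I : ℕ → ℕ := fun j => Nat.findGreatest (fun i => K i ≤ j) j with hI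
  have hmono : Monotone I := fun a b hab =>
    Nat.findGreatest_mono (fun i hi => le_trans hi hab) hab
  have hI_ge : ∀ M j, M ≤ j → K M ≤ j → M ≤ I j := fun M j h1 h2 => Nat.le_findGreatest h1 h2
  have hI_tendsto : Tendsto (fun j => 1 / ((I j : ℝ) + 1)) atTop (𝓝 0) := by
    refine tendsto_one_div_add_atTop_nhds_zero_nat.comp (tendsto_atTop.2 fun M => ?_)
    filter_upwards [eventually_ge_atTop M, eventually_ge_atTop (K M)] with j h1 h2
    exact hI_ge M j h1 h2
  refine ⟨{j | φ j < 1 / ((I j : ℝ) + 1)}, fullDensityIdx_of_tendsto_card_compl ?_, ?_⟩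
  · refine squeeze_zero' (Eventually.of_forall fun k => by positivity) ?_ hI_tendsto
    filter_upwards [eventually_ge_atTop (K 0)] with k hk
    have hKI : K (I k) ≤ k := Nat.findGreatest_spec (P := fun i => K i ≤ k) (Nat.zero_le k) hk
    refine le_trans ?_ (hK (I k) k hKI)
    gcongr with j hj
    intro hj2
    simp only [not_lt] at hj2
    refine le_trans ?_ hj2
    have := hmono (mem_Icc.1 hj).2
    gcongr
  · intro ε hε
    rw [eventually_inf_principal]
    filter_upwards [hI_tendsto.eventually_lt_const hε] with j h1 h2
    exact lt_trans h2 h1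

end Density

section Interlacing

open Finset
open scoped Classical

variable {nseq : ℕ → ℕ} {lam : ℕ → ℝ} {ntil : ℕ → ℕ}

theorem ntil_eq_or_eq (hmono : StrictMono nseq) (hrange : Set.range nseq = SOS)
    (hinter : ∀ j : ℕ, 1 ≤ j → (nseq (j - 1) : ℝ) < lam j ∧ lam j < (nseq j : ℝ))
    (hmem : ∀ j, ntil j ∈ SOS)
    (hmin : ∀ j, ∀ m ∈ SOS, |(ntil j : ℝ) - lam j| ≤ |(m : ℝ) - lam j|) {j : ℕ} (hj : 1 ≤ j) :
    ntil j = nseq (j - 1) ∨ ntil j = nseq j := by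
  obtain ⟨h1, h2⟩ := hinter j hj
  have hi := hmem j
  rw [← hrange] at hi
  obtain ⟨i, hi⟩ := hi
  have hS : ∀ i, nseq i ∈ SOS := fun i => by rw [← hrange]; exact ⟨i, rfl⟩
  rcases lt_trichotomy i (j - 1) with h | h | h
  · exfalso
    have h3 : (nseq i : ℝ) < nseq (j - 1) := by exact_mod_cast hmono h
    have h4 := hmin j _ (hS (j - 1))
    rw [← hi, abs_of_neg (by linarith), abs_of_neg (by linarith)] at h4
    linarith
  · left; rw [← hi, h]
  · rcases (by omega : i = j ∨ j < i) with h | h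
    · right; rw [← hi, h]
    · exfalso
      have h3 : (nseq j : ℝ) < nseq i := by exact_mod_cast hmono h
      have h4 := hmin j _ (hS j)
      rw [← hi, abs_of_pos (by linarith), abs_of_pos (by linarith)] at h4
      linarith

theorem nseq_zero (hmono : StrictMono nseq) (hrange : Set.range nseq = SOS) : nseq 0 = 0 := by
  have h0 : (0 : ℕ) ∈ SOS := ⟨0, 0, by norm_num⟩
  rw [← hrange] at h0
  obtain ⟨i, hi⟩ := h0
  have := hmono.monotone (Nat.zero_le i)
  omega

theorem card_SOS_le (hmono : StrictMono nseq) (hrange : Set.range nseq = SOS) (k : ℕ) :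
    #{n ∈ Ioc 0 (nseq k) | n ∈ SOS} ≤ k := by
  have h1 : {n ∈ Ioc 0 (nseq k) | n ∈ SOS} ⊆ (Icc 1 k).image nseq := by
    intro n hn
    rw [mem_filter, mem_Ioc, ← hrange] at hn
    obtain ⟨⟨h1, h2⟩, i, rfl⟩ := hn
    rw [mem_image]
    refine ⟨i, mem_Icc.2 ⟨?_, hmono.le_iff_le.1 h2⟩, rfl⟩
    rcases Nat.eq_zero_or_pos i with rfl | h
    · rw [nseq_zero hmono hrange] at h1; omega
    · exact h
  refine (card_le_card h1).trans (card_image_le.trans (le_of_eq ?_))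
  rw [Nat.card_Icc, Nat.add_sub_cancel]

theorem card_index_le (hmono : StrictMono nseq) (hrange : Set.range nseq = SOS)
    (hor : ∀ j, 1 ≤ j → ntil j = nseq (j - 1) ∨ ntil j = nseq j) (P : ℕ → Prop) (k : ℕ) :
    #{j ∈ Icc 1 k | P (ntil j)} ≤ 2 * #{n ∈ Ioc 0 (nseq k) | n ∈ SOS ∧ P n} + 1 := by
  set T := {n ∈ Ioc 0 (nseq k) | n ∈ SOS ∧ P n} with hT
  have hS : ∀ i, nseq i ∈ SOS := fun i => by rw [← hrange]; exact ⟨i, rfl⟩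
  have h0 := nseq_zero hmono hrange
  have hT_mem : ∀ i ≤ k, 1 ≤ i → P (nseq i) → nseq i ∈ T := by
    intro i hi hi1 hP
    rw [hT, mem_filter, mem_Ioc]
    exact ⟨⟨by rw [← h0]; exact hmono (by omega), hmono.monotone hi⟩, hS i, hP⟩
  have h1 : #{j ∈ Icc 1 k | P (nseq j)} ≤ #T := by
    refine card_le_card_of_injOn nseq (fun j hj => ?_) hmono.injective.injOn
    have hj' := mem_filter.1 hj
    rw [mem_Icc] at hj'
    exact hT_mem j hj'.1.2 hj'.1.1 hj'.2
  have h2 : #{j ∈ Icc 1 k | P (nseq (j - 1))} ≤ #(insert 0 T) := by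
    refine card_le_card_of_injOn (fun j => nseq (j - 1)) (fun j hj => ?_) ?_
    · have hj' := mem_filter.1 hj
      rw [mem_Icc] at hj'
      rw [mem_coe, mem_insert]
      rcases Nat.eq_zero_or_pos (j - 1) with h | h
      · left; simp only [h, h0]
      · right; exact hT_mem (j - 1) (by omega) h hj'.2
    · intro a ha b hb hab
      have ha' := mem_Icc.1 (mem_filter.1 ha).1
      have hb' := mem_Icc.1 (mem_filter.1 hb).1
      have := hmono.injective hab
      omega
  have h3 : {j ∈ Icc 1 k | P (ntil j)} ⊆
      {j ∈ Icc 1 k | P (nseq j)} ∪ {j ∈ Icc 1 k | P (nseq (j - 1))} := by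
    intro j hj
    rw [mem_filter] at hj
    rw [mem_union, mem_filter, mem_filter]
    rcases hor j (mem_Icc.1 hj.1).1 with h | h
    · right; rw [← h]; exact hj
    · left; rw [← h]; exact hj
  have h4 := (card_le_card h3).trans (card_union_le _ _)
  have h5 := card_insert_le 0 T
  omega

theorem exists_nseq_div_le (hmono : StrictMono nseq) (hrange : Set.range nseq = SOS) :
    ∃ C > 0, ∀ᶠ k : ℕ in atTop, 1 / (k : ℝ) ≤ C * (√(Real.log (nseq k)) / nseq k) := by
  obtain ⟨c, hc, N₀, h⟩ := exists_le_card_SOS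
  refine ⟨1 / c, by positivity, ?_⟩
  filter_upwards [eventually_ge_atTop (max N₀ 2)] with k hk
  have hX : k ≤ nseq k := hmono.id_le k
  have hk2 : 2 ≤ k := le_trans (le_max_right _ _) hk
  have hX0 : (0 : ℝ) < nseq k := by exact_mod_cast (by omega : 0 < nseq k)
  have hk0 : (0 : ℝ) < k := by exact_mod_cast (by omega : 0 < k)
  have hL : 0 < Real.log (nseq k) :=
    Real.log_pos (by exact_mod_cast (by omega : 1 < nseq k))
  have hs := Real.sqrt_pos.2 hL
  have h1 := h (nseq k) (((le_max_left _ _).trans hk).trans hX)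
  have h2 : c * nseq k / √(Real.log (nseq k)) ≤ k :=
    h1.trans (by exact_mod_cast card_SOS_le hmono hrange k)
  rw [div_le_iff₀ hs] at h2
  rw [div_mul_div_comm, one_mul, div_le_div_iff₀ hk0 (by positivity)]
  linarith

theorem tendsto_card_index_div {P : ℕ → ℕ → Prop} (hmono : StrictMono nseq)
    (hrange : Set.range nseq = SOS)
    (hor : ∀ j, 1 ≤ j → ntil j = nseq (j - 1) ∨ ntil j = nseq j)
    (h : Tendsto (fun N : ℕ => (#{n ∈ Ioc 0 N | n ∈ SOS ∧ P N n} : ℝ) * (√(Real.log N) / N))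
      atTop (𝓝 0)) :
    Tendsto (fun k : ℕ => (#{j ∈ Icc 1 k | P (nseq k) (ntil j)} : ℝ) / k) atTop (𝓝 0) := by
  obtain ⟨C, hC, hCk⟩ := exists_nseq_div_le hmono hrange
  have h1 := ((h.comp hmono.tendsto_atTop).const_mul (2 * C)).add
    (tendsto_one_div_atTop_nhds_zero_nat (𝕜 := ℝ))
  rw [mul_zero, zero_add] at h1
  refine squeeze_zero' (Eventually.of_forall fun k => by positivity) ?_ h1
  filter_upwards [hCk] with k hk
  have h2 : (#{j ∈ Icc 1 k | P (nseq k) (ntil j)} : ℝ) ≤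
      2 * #{n ∈ Ioc 0 (nseq k) | n ∈ SOS ∧ P (nseq k) n} + 1 := by
    exact_mod_cast card_index_le hmono hrange hor (P (nseq k)) k
  calc _ ≤ (2 * #{n ∈ Ioc 0 (nseq k) | n ∈ SOS ∧ P (nseq k) n} + 1) * (1 / (k : ℝ)) := by
        rw [mul_one_div]; gcongr
    _ = 2 * #{n ∈ Ioc 0 (nseq k) | n ∈ SOS ∧ P (nseq k) n} * (1 / (k : ℝ)) + 1 / k := by ring
    _ ≤ 2 * #{n ∈ Ioc 0 (nseq k) | n ∈ SOS ∧ P (nseq k) n} *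
          (C * (√(Real.log (nseq k)) / nseq k)) + 1 / k := by gcongr
    _ = _ := by simp only [Function.comp]; ring

theorem tendsto_card_large_tailSum :
    Tendsto (fun N : ℕ => (#{n ∈ Ioc 0 N | n ∈ SOS ∧
      Real.log N ^ (3 / 4 : ℝ) / 4 < tailSum n} : ℝ) * (√(Real.log N) / N)) atTop (𝓝 0) := by
  obtain ⟨C, hC, h⟩ := exists_sum_tailSum_le
  have h1 := ((tendsto_rpow_neg_atTop (by norm_num : (0 : ℝ) < 1 / 4)).comp
    tendsto_log_natCast).const_mul (4 * C)
  rw [mul_zero] at h1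
  refine squeeze_zero' (Eventually.of_forall fun k => by positivity) ?_ h1
  filter_upwards [eventually_ge_atTop 2] with N hN
  have hN0 : (0 : ℝ) < N := by exact_mod_cast (by omega : 0 < N)
  have hL : 0 < Real.log N := Real.log_pos (by exact_mod_cast (by omega : 1 < N))
  set B := {n ∈ Ioc 0 N | n ∈ SOS ∧ Real.log N ^ (3 / 4 : ℝ) / 4 < tailSum n} with hB
  have h2 : (#B : ℝ) * (Real.log N ^ (3 / 4 : ℝ) / 4) ≤ C * N := by
    rw [← nsmul_eq_mul]
    refine ((card_nsmul_le_sum B tailSum _ fun n hn => ?_).trans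
      (sum_le_sum_of_subset_of_nonneg (filter_subset _ _) fun n _ _ => tailSum_nonneg n)).trans
      (h N hN)
    exact (mem_filter.1 hn).2.2.le
  have hp : 0 < Real.log N ^ (3 / 4 : ℝ) := by positivity
  have h3 : (#B : ℝ) ≤ 4 * C * N / Real.log N ^ (3 / 4 : ℝ) := by
    rw [le_div_iff₀ hp]; linarith
  refine (mul_le_mul_of_nonneg_right h3 (by positivity)).trans (le_of_eq ?_)
  simp only [Function.comp]
  rw [show -(1 / 4 : ℝ) = 1 / 2 - 3 / 4 by norm_num, Real.rpow_sub hL, Real.sqrt_eq_rpow]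
  field_simp

theorem avgD_nseq (hmono : StrictMono nseq)
    (hinter : ∀ j : ℕ, 1 ≤ j → (nseq (j - 1) : ℝ) < lam j ∧ lam j < (nseq j : ℝ))
    (D : ℕ → ℝ) (k : ℕ) : avgD lam D (nseq k) = (∑ j ∈ Icc 1 k, D j) / k := by
  have hiff : (fun j => 1 ≤ j ∧ lam j ≤ nseq k) = fun j => j ∈ Icc 1 k := by
    funext j
    rw [mem_Icc, eq_iff_iff]
    refine and_congr_right fun hj => ?_
    obtain ⟨h1, h2⟩ := hinter j hj
    constructor
    · intro h
      by_contra hjk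
      have : (nseq k : ℝ) ≤ nseq (j - 1) := by
        exact_mod_cast hmono.monotone (by omega : k ≤ j - 1)
      linarith
    · intro h
      have : (nseq j : ℝ) ≤ nseq k := by exact_mod_cast hmono.monotone h
      linarith
  have h1 : ∀ p : ℕ → Prop, p = (fun j => j ∈ Icc 1 k) →
      (∑' j : {j // p j}, D j) / (Nat.card {j // p j} : ℝ) = (∑ j ∈ Icc 1 k, D j) / k := by
    rintro p rfl
    rw [Finset.tsum_subtype (Icc 1 k) D, Nat.card_eq_fintype_card, Fintype.card_coe,
      Nat.card_Icc, Nat.add_sub_cancel]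
  exact h1 _ hiff

theorem tendsto_card_large_distance (hmono : StrictMono nseq)
    (hinter : ∀ j : ℕ, 1 ≤ j → (nseq (j - 1) : ℝ) < lam j ∧ lam j < (nseq j : ℝ))
    {D : ℕ → ℝ} (hD : ∀ j, 0 ≤ D j)
    (hweak : (fun x : ℝ => avgD lam D x) =O[atTop]
      fun x : ℝ => Real.log x ^ (-(1 / 2) : ℝ)) :
    Tendsto (fun k : ℕ => (#{j ∈ Icc 1 k | Real.log (nseq k) ^ (-(3 / 8) : ℝ) < D j} : ℝ) / k)
      atTop (𝓝 0) := by
  obtain ⟨C, hC⟩ := hweak.bound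
  have hX : Tendsto (fun k => (nseq k : ℝ)) atTop atTop :=
    tendsto_natCast_atTop_atTop.comp hmono.tendsto_atTop
  have h1 := ((tendsto_rpow_neg_atTop (by norm_num : (0 : ℝ) < 1 / 8)).comp
    (Real.tendsto_log_atTop.comp hX)).const_mul C
  rw [mul_zero] at h1
  refine squeeze_zero' (Eventually.of_forall fun k => by positivity) ?_ h1
  filter_upwards [eventually_ge_atTop 1, hX.eventually hC,
    (Real.tendsto_log_atTop.comp hX).eventually_gt_atTop 0] with k hk h2 hL
  simp only [Function.comp] at hL ⊢
  have hk0 : (0 : ℝ) < k := by exact_mod_cast hk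
  set L := Real.log (nseq k)
  rw [avgD_nseq hmono hinter, Real.norm_of_nonneg
    (div_nonneg (sum_nonneg fun j _ => hD j) hk0.le), Real.norm_of_nonneg (by positivity),
    div_le_iff₀ hk0] at h2
  have h3 : (#{j ∈ Icc 1 k | L ^ (-(3 / 8) : ℝ) < D j} : ℝ) * L ^ (-(3 / 8) : ℝ) ≤
      C * L ^ (-(1 / 2) : ℝ) * k := by
    rw [← nsmul_eq_mul]
    refine ((card_nsmul_le_sum _ D _ fun n hn => ?_).trans
      (sum_le_sum_of_subset_of_nonneg (filter_subset _ _) fun n _ _ => hD n)).trans h2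
    exact (mem_filter.1 hn).2.le
  have hp : 0 < L ^ (-(3 / 8) : ℝ) := by positivity
  rw [div_le_iff₀ hk0]
  refine le_of_mul_le_mul_right (h3.trans (le_of_eq ?_)) hp
  rw [show -(1 / 2 : ℝ) = -(1 / 8) + -(3 / 8) by norm_num, Real.rpow_add hL]
  ring

theorem tendsto_card_large_remainder (hmono : StrictMono nseq) (hrange : Set.range nseq = SOS)
    (hinter : ∀ j : ℕ, 1 ≤ j → (nseq (j - 1) : ℝ) < lam j ∧ lam j < (nseq j : ℝ))
    (hor : ∀ j, 1 ≤ j → ntil j = nseq (j - 1) ∨ ntil j = nseq j)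
    {D : ℕ → ℝ} (hD : ∀ j, 0 ≤ D j)
    (hweak : (fun x : ℝ => avgD lam D x) =O[atTop]
      fun x : ℝ => Real.log x ^ (-(1 / 2) : ℝ)) :
    Tendsto (fun k : ℕ => (#{j ∈ Icc 1 k | 1 < 4 * D j ^ 2 * tailSum (ntil j)} : ℝ) / k)
      atTop (𝓝 0) := by
  have h1 := tendsto_card_large_distance hmono hinter hD hweak
  have h2 := tendsto_card_index_div (P := fun N n => Real.log N ^ (3 / 4 : ℝ) / 4 < tailSum n)
    hmono hrange hor tendsto_card_large_tailSum
  have h3 := h1.add h2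
  rw [add_zero] at h3
  refine squeeze_zero' (Eventually.of_forall fun k => by positivity) ?_ h3
  filter_upwards [eventually_ge_atTop 2] with k hk
  have hX : k ≤ nseq k := hmono.id_le k
  have hL : 0 < Real.log (nseq k) :=
    Real.log_pos (by exact_mod_cast (by omega : 1 < nseq k))
  rw [← add_div]
  gcongr
  norm_cast
  refine le_trans (card_le_card fun j hj => ?_) (card_union_le _ _)
  rw [mem_filter] at hj
  rw [mem_union, mem_filter, mem_filter]
  by_contra hcon
  push Not at hcon
  obtain ⟨h4, h5⟩ := hcon
  have h4 := h4 hj.1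
  have h5 := h5 hj.1
  have h6 : D j ^ 2 ≤ Real.log (nseq k) ^ (-(3 / 4) : ℝ) := by
    calc D j ^ 2 ≤ (Real.log (nseq k) ^ (-(3 / 8) : ℝ)) ^ 2 := by
          gcongr
          exact hD j
      _ = _ := by rw [← Real.rpow_natCast, ← Real.rpow_mul hL.le]; norm_num
  have h7 : D j ^ 2 * tailSum (ntil j) ≤
      Real.log (nseq k) ^ (-(3 / 4) : ℝ) * (Real.log (nseq k) ^ (3 / 4 : ℝ) / 4) := by
    gcongr
    exact tailSum_nonneg _
  rw [mul_div_assoc', ← Real.rpow_add hL] at h7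
  norm_num at h7
  linarith [hj.2]

end Interlacing

section Scaling

open Finset
open scoped Classical

theorem tendsto_log_div_of_le {ι : Type*} {l : Filter ι} {a b L : ι → ℝ} {c K : ℝ}
    (hL : Tendsto L l atTop) (ha : Tendsto (fun i => a i / L i) l (𝓝 c))
    (h1 : ∀ᶠ i in l, a i ≤ b i) (h2 : ∀ᶠ i in l, b i ≤ a i + K) :
    Tendsto (fun i => b i / L i) l (𝓝 c) := by
  have h3 := ha.add (hL.const_div_atTop K)
  rw [add_zero] at h3
  refine tendsto_of_tendsto_of_tendsto_of_le_of_le' ha h3 ?_ ?_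
  · filter_upwards [h1, hL.eventually_gt_atTop 0] with i hi hp
    gcongr
  · filter_upwards [h2, hL.eventually_gt_atTop 0] with i hi hp
    rw [← add_div]
    gcongr

end Scaling

/-- Weak coupling: along a full density set of indices, the fractal exponents satisfy
`d_q = D_q = 1` with respect to the scaling parameter `N = (log ñ_j)^{(1/2) log 2}`. -/
theorem weak_coupling_simple_scaling
    (nseq : ℕ → ℕ) (hmono : StrictMono nseq) (hrange : Set.range nseq = SOS)
    (lam : ℕ → ℝ)
    (hinter : ∀ j : ℕ, 1 ≤ j → (nseq (j - 1) : ℝ) < lam j ∧ lam j < (nseq j : ℝ))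
    (ntil : ℕ → ℕ) (D : ℕ → ℝ)
    (hD : ∀ j, D j = |(ntil j : ℝ) - lam j|)
    (hnear : ∀ j, ntil j ∈ SOS ∧
      (∀ m ∈ SOS, |(ntil j : ℝ) - lam j| ≤ |(m : ℝ) - lam j|) ∧
      (∀ m ∈ SOS, |(m : ℝ) - lam j| = |(ntil j : ℝ) - lam j| → ntil j ≤ m))
    (hweak : (fun x : ℝ => avgD lam D x) =O[atTop]
      fun x : ℝ => Real.log x ^ (-(1 / 2) : ℝ)) :
    ∃ J : Set ℕ, FullDensityIdx J ∧
      (∀ q : ℝ, 1 ≤ q →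
        Tendsto (fun j : ℕ => Real.log (mq q (lam j) (D j)) /
            ((1 / 2 * Real.log 2) * Real.log (Real.log (ntil j))))
          (atTop ⊓ 𝓟 J) (𝓝 1)) ∧
      (∀ q : ℝ, 1 < q →
        Tendsto (fun j : ℕ =>
            (Real.log (mq q (lam j) (D j)) - q * Real.log (mq 1 (lam j) (D j))) /
              ((1 - q) * ((1 / 2 * Real.log 2) * Real.log (Real.log (ntil j)))))
          (atTop ⊓ 𝓟 J) (𝓝 1)) := by
  classical
  have hor : ∀ j, 1 ≤ j → ntil j = nseq (j - 1) ∨ ntil j = nseq j := fun j hj =>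
    ntil_eq_or_eq hmono hrange hinter (fun j => (hnear j).1) (fun j => (hnear j).2.1) hj
  have hD0 : ∀ j, 0 ≤ D j := fun j => by rw [hD]; positivity
  have hDpos : ∀ j, 1 ≤ j → 0 < |(ntil j : ℝ) - lam j| := by
    intro j hj
    obtain ⟨h1, h2⟩ := hinter j hj
    rw [abs_pos, sub_ne_zero]
    rcases hor j hj with h | h
    · rw [h]; exact h1.ne
    · rw [h]; exact h2.ne'
  have hntil : Tendsto ntil atTop atTop := by
    refine tendsto_atTop_mono' _ ?_ (tendsto_sub_atTop_nat 1)
    filter_upwards [eventually_ge_atTop 1] with j hj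
    have h1 : j - 1 ≤ nseq (j - 1) := hmono.id_le _
    have h2 : j ≤ nseq j := hmono.id_le _
    rcases hor j hj with h | h <;> omega
  set c := 1 / 2 * Real.log 2 with hc
  have hc0 : 0 < c := by
    have : 0 < Real.log 2 := Real.log_pos (by norm_num)
    positivity
  set G : ℕ → ℝ := fun j => Real.log ((r2 (ntil j) : ℝ) / 4) with hG
  set L : ℕ → ℝ := fun j => Real.log (Real.log (ntil j)) with hLdef
  have hL : Tendsto L atTop atTop :=
    Real.tendsto_log_atTop.comp (tendsto_log_natCast.comp hntil)
  obtain ⟨J, hJ, hφ⟩ := exists_fullDensityIdx_eventually_lt (fun j => |G j - c * L j| / L j +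
      if 1 < 4 * D j ^ 2 * tailSum (ntil j) then 1 else 0) (by
    intro ε hε
    have h1 := tendsto_card_large_remainder hmono hrange hinter hor hD0 hweak
    have h2 := tendsto_card_index_div (P := fun _ n => ε * Real.log (Real.log n) ≤
      |Real.log ((r2 n : ℝ) / 4) - c * Real.log (Real.log n)|) hmono hrange hor
      (tendsto_card_abnormal hε)
    have h3 := h1.add h2
    rw [add_zero] at h3
    refine squeeze_zero (fun k => by positivity) (fun k => ?_) h3
    rw [← add_div]
    gcongr
    norm_cast
    refine le_trans (Finset.card_le_card fun j hj => ?_) (Finset.card_union_le _ _)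
    rw [Finset.mem_filter] at hj
    rw [Finset.mem_union, Finset.mem_filter, Finset.mem_filter]
    by_cases h4 : 1 < 4 * D j ^ 2 * tailSum (ntil j)
    · exact Or.inl ⟨hj.1, h4⟩
    · right
      refine ⟨hj.1, ?_⟩
      have h5 := hj.2
      rw [if_neg h4, Nat.cast_zero, add_zero] at h5
      change ε * L j ≤ |G j - c * L j|
      rcases le_or_gt (L j) 0 with h6 | h6
      · have := div_nonpos_of_nonneg_of_nonpos (abs_nonneg (G j - c * L j)) h6
        linarith
      · rwa [le_div_iff₀ h6] at h5)
  have hLJ : Tendsto L (atTop ⊓ 𝓟 J) atTop := hL.mono_left inf_le_left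
  have hGL : Tendsto (fun j => G j / L j) (atTop ⊓ 𝓟 J) (𝓝 c) := by
    rw [Metric.tendsto_nhds]
    intro ε hε
    filter_upwards [hφ ε hε, hLJ.eventually_gt_atTop 0] with j h1 h2
    have h3 : |G j - c * L j| / L j < ε := by
      refine lt_of_le_of_lt ?_ h1
      exact le_add_of_nonneg_right (by split_ifs <;> norm_num)
    rw [Real.dist_eq, show G j / L j - c = (G j - c * L j) / L j by field_simp, abs_div,
      abs_of_pos h2]
    exact h3
  have hrem : ∀ᶠ j in atTop ⊓ 𝓟 J, 4 * D j ^ 2 * tailSum (ntil j) ≤ 1 := by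
    filter_upwards [hφ 1 one_pos, hLJ.eventually_gt_atTop 0] with j h1 h2
    by_contra h3
    rw [if_pos (not_le.1 h3)] at h1
    have : 0 ≤ |G j - c * L j| / L j := by positivity
    linarith
  have hlarge : ∀ᶠ j in atTop ⊓ 𝓟 J, 1 ≤ j ∧ 1 ≤ ntil j :=
    ((eventually_ge_atTop 1).and (hntil.eventually_ge_atTop 1)).filter_mono inf_le_left
  have hmq : ∀ q : ℝ, 1 ≤ q → Tendsto (fun j : ℕ => Real.log (mq q (lam j) (D j)) /
      (c * L j)) (atTop ⊓ 𝓟 J) (𝓝 1) := by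
    intro q hq
    have hbounds : ∀ᶠ j in atTop ⊓ 𝓟 J, G j ≤ Real.log (mq q (lam j) (D j)) ∧
        Real.log (mq q (lam j) (D j)) ≤ G j + Real.log 8 := by
      filter_upwards [hrem, hlarge] with j h1 h2
      have h3 := r2_le_mq_and_mq_le hq (hDpos j h2.1) (hnear j).2.1
      rw [← hD] at h3
      obtain ⟨h4, h5⟩ := h3
      have h6 := one_le_r2_div_four (by omega : ntil j ≠ 0) (r2_ne_zero_iff.2 (hnear j).1)
      simp only [hG]
      constructor
      · exact Real.log_le_log (by linarith) (by linarith)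
      · rw [← Real.log_mul (by linarith) (by norm_num)]
        exact Real.log_le_log (by linarith) (by linarith)
    have h1 := (tendsto_log_div_of_le hLJ hGL (hbounds.mono fun _ h => h.1)
      (hbounds.mono fun _ h => h.2)).div_const c
    rw [div_self hc0.ne'] at h1
    refine h1.congr fun j => ?_
    rw [div_div, mul_comm]
  refine ⟨J, hJ, hmq, fun q hq => ?_⟩
  have h1 := ((hmq q hq.le).sub ((hmq 1 le_rfl).const_mul q)).div_const (1 - q)
  rw [mul_one, div_self (by linarith)] at h1
  refine h1.congr fun j => ?_
  rw [mul_div_assoc', ← sub_div, div_div, mul_comm (1 - q)]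
end
end

section
/- Let q > 1/2. Suppose G = G(T) > 0 satisfies G(T) → ∞ and G(T)/T → 0 as T → ∞. Then G(T)^{2q−1} · (1/T) · ∫_T^{2T} τ_q(t, G(T)) dt → 2π/(2q−1) as T → ∞; that is, the mean tail ⟨τ_q⟩_T = (1/T)∫_T^{2T} τ_q(t,G) dt satisfies ⟨τ_q⟩_T ∼ (2π/(2q−1))·G^{1−2q}. -/
open Filter Topology

noncomputable section

/-- The tail `τ_q(t, G) = ∑_{m ∈ 𝒩, |m − t| ≥ G} r₂(m) |m − t|^{−2q}`
(the summand vanishes for `m ∉ 𝒩` since then `r₂(m) = 0`). -/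
def tauq (q t G : ℝ) : ℝ :=
  ∑' m : {m : ℕ // G ≤ |(m : ℝ) - t|}, (r2 (m : ℕ) : ℝ) * |((m : ℕ) : ℝ) - t| ^ (-(2 * q))

open MeasureTheory Set ENNReal

/-- The summatory function `∑_{m ≤ x} r₂(m)`. -/
def r2Sum (x : ℝ) : ℝ := ∑ m ∈ Finset.range (⌊x⌋₊ + 1), (r2 m : ℝ)

lemma finite_sq_add_sq_eq (n : ℕ) : Finite {p : ℤ × ℤ // p.1 ^ 2 + p.2 ^ 2 = (n : ℤ)} := by
  refine ((Set.finite_Icc (-(n : ℤ)) n).prod (Set.finite_Icc (-(n : ℤ)) n)).subset ?_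
  rintro ⟨a, b⟩ (h : a ^ 2 + b ^ 2 = (n : ℤ))
  simp only [Set.mem_prod, Set.mem_Icc]
  refine ⟨⟨?_, ?_⟩, ?_, ?_⟩ <;> nlinarith [sq_nonneg a, sq_nonneg b, Int.le_self_sq a,
    Int.le_self_sq b, Int.le_self_sq (-a), Int.le_self_sq (-b)]

lemma card_sq_add_sq_le {c : ℝ} (hc : 0 ≤ c) :
    (Nat.card {p : ℤ × ℤ // ((p.1 : ℝ) ^ 2 + (p.2 : ℝ) ^ 2) ≤ c} : ℝ) = r2Sum c := by
  have e : {p : ℤ × ℤ // ((p.1 : ℝ) ^ 2 + (p.2 : ℝ) ^ 2) ≤ c} ≃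
      Σ m : Fin (⌊c⌋₊ + 1), {p : ℤ × ℤ // p.1 ^ 2 + p.2 ^ 2 = ((m : ℕ) : ℤ)} :=
    { toFun := fun p => ⟨⟨(p.1.1 ^ 2 + p.1.2 ^ 2).toNat, by
          have hn : 0 ≤ p.1.1 ^ 2 + p.1.2 ^ 2 := by positivity
          have := p.2
          rw [Nat.lt_succ_iff, Nat.le_floor_iff hc]
          have h2 : (((p.1.1 ^ 2 + p.1.2 ^ 2).toNat : ℤ) : ℝ) = (p.1.1 : ℝ) ^ 2 + (p.1.2 : ℝ) ^ 2 := by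
            rw [Int.toNat_of_nonneg hn]; push_cast; ring
          rw [Int.cast_natCast] at h2
          rwa [h2]⟩, ⟨p.1, by
          have hn : 0 ≤ p.1.1 ^ 2 + p.1.2 ^ 2 := by positivity
          exact (Int.toNat_of_nonneg hn).symm⟩⟩
      invFun := fun x => ⟨x.2.1, by
        have h := x.2.2
        have hm := x.1.2
        rw [Nat.lt_succ_iff, Nat.le_floor_iff hc] at hm
        have h2 : ((x.2.1.1 : ℝ) ^ 2 + (x.2.1.2 : ℝ) ^ 2) = ((x.1 : ℕ) : ℝ) := by exact_mod_cast h
        rwa [h2]⟩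
      left_inv := fun p => rfl
      right_inv := by
        rintro ⟨⟨m, hm⟩, ⟨p, hp⟩⟩
        have : m = (p.1 ^ 2 + p.2 ^ 2).toNat := by rw [hp]; simp
        subst this
        rfl }
  have := finite_sq_add_sq_eq
  rw [Nat.card_congr e, Nat.card_sigma, r2Sum, Finset.sum_range]
  push_cast
  rfl

lemma convex_sq_add_sq_le_one : Convex ℝ {x : Fin 2 → ℝ | x 0 ^ 2 + x 1 ^ 2 ≤ 1} := by
  have h0 : ConvexOn ℝ Set.univ (fun x : Fin 2 → ℝ => x 0 ^ 2) :=
    (even_two.convexOn_pow (𝕜 := ℝ)).comp_linearMap (LinearMap.proj (R := ℝ) (φ := fun _ : Fin 2 => ℝ) 0)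
  have h1 : ConvexOn ℝ Set.univ (fun x : Fin 2 → ℝ => x 1 ^ 2) :=
    (even_two.convexOn_pow (𝕜 := ℝ)).comp_linearMap (LinearMap.proj (R := ℝ) (φ := fun _ : Fin 2 => ℝ) 1)
  simpa using (h0.add h1).convex_le 1

lemma volume_real_sq_add_sq_le_one :
    volume.real {x : Fin 2 → ℝ | x 0 ^ 2 + x 1 ^ 2 ≤ 1} = Real.pi := by
  have h := (PiLp.volume_preserving_toLp (Fin 2)).measure_preimage
    (measurableSet_closedBall (x := (0 : EuclideanSpace ℝ (Fin 2)))
      (ε := 1)).nullMeasurableSet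
  rw [EuclideanSpace.volume_closedBall_fin_two, EuclideanSpace.closedBall_zero_eq _ zero_le_one] at h
  simp only [Set.preimage_ofPred_eq, Fin.sum_univ_two, one_pow, ENNReal.ofReal_one, one_mul] at h
  rw [measureReal_def, h, ENNReal.toReal_ofReal Real.pi_pos.le]

lemma covolume_span_basisFun :
    ZLattice.covolume (Submodule.span ℤ (Set.range (Pi.basisFun ℝ (Fin 2)))) = 1 := by
  rw [ZLattice.covolume_eq_measure_fundamentalDomain _ volume
    (ZSpan.isAddFundamentalDomain (Pi.basisFun ℝ (Fin 2)) volume), measureReal_def,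
    ZSpan.fundamentalDomain_pi_basisFun, volume_pi, Measure.pi_pi]
  simp

lemma mem_span_basisFun_iff (x : Fin 2 → ℝ) :
    x ∈ Submodule.span ℤ (Set.range (Pi.basisFun ℝ (Fin 2))) ↔ ∀ i, ∃ n : ℤ, (n : ℝ) = x i := by
  rw [Module.Basis.mem_span_iff_repr_mem]
  simp

/-- The leading term of the Gauss circle problem. -/
lemma tendsto_r2Sum_div : Tendsto (fun x => r2Sum x / x) atTop (𝓝 Real.pi) := by
  have h := ZLattice.covolume.tendsto_card_le_div
    (Submodule.span ℤ (Set.range (Pi.basisFun ℝ (Fin 2)))) (X := Set.univ)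
    (F := fun x => x 0 ^ 2 + x 1 ^ 2) (by simp) (by intro x r _; simp; ring) ?_ ?_ ?_
  · simp only [Set.mem_univ, true_and] at h
    rw [volume_real_sq_add_sq_le_one, covolume_span_basisFun, div_one] at h
    refine h.congr' ?_
    filter_upwards [eventually_ge_atTop 0] with c hc
    rw [← card_sq_add_sq_le hc]
    congr 2
    have hmem (p : {p : ℤ × ℤ // ((p.1 : ℝ) ^ 2 + (p.2 : ℝ) ^ 2) ≤ c}) :
        ![(p.1.1 : ℝ), (p.1.2 : ℝ)] ∈ ({x | x 0 ^ 2 + x 1 ^ 2 ≤ c} ∩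
          Submodule.span ℤ (Set.range (Pi.basisFun ℝ (Fin 2))) : Set (Fin 2 → ℝ)) := by
      refine ⟨by simpa using p.2, ?_⟩
      rw [SetLike.mem_coe, mem_span_basisFun_iff]
      intro i
      fin_cases i
      · exact ⟨p.1.1, rfl⟩
      · exact ⟨p.1.2, rfl⟩
    refine (Nat.card_congr (Equiv.ofBijective (fun p => ⟨_, hmem p⟩) ⟨?_, ?_⟩)).symm
    · rintro ⟨⟨a, b⟩, _⟩ ⟨⟨a', b'⟩, _⟩ h
      have h := congrArg Subtype.val h
      have h0 := congrFun h 0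
      have h1 := congrFun h 1
      simp at h0 h1
      simp [h0, h1]
    · rintro ⟨x, hx, hL⟩
      rw [SetLike.mem_coe, mem_span_basisFun_iff] at hL
      obtain ⟨a, ha⟩ := hL 0
      obtain ⟨b, hb⟩ := hL 1
      refine ⟨⟨(a, b), ?_⟩, ?_⟩
      · simpa [ha, hb] using hx
      · ext i
        fin_cases i <;> simp [ha, hb]
  · refine (Metric.isBounded_closedBall (x := (0 : Fin 2 → ℝ)) (r := 1)).subset ?_
    rintro x ⟨-, hx⟩
    simp only [mem_closedBall_zero_iff]
    refine (pi_norm_le_iff_of_nonneg zero_le_one).2 fun i => ?_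
    rw [Real.norm_eq_abs, ← sq_le_one_iff_abs_le_one]
    fin_cases i
    · exact (le_add_of_nonneg_right (sq_nonneg _)).trans hx
    · exact (le_add_of_nonneg_left (sq_nonneg _)).trans hx
  · simp only [Set.mem_univ, true_and]
    exact measurableSet_le (by fun_prop) (by fun_prop)
  · simpa using convex_sq_add_sq_le_one.addHaar_frontier volume

/-- The lattice points counted with multiplicity `r₂(m)`, each weighted by the measure of the
`t ∈ (T, 2T]` with `G ≤ |m - t| < s`. -/
def shellMass (G T s : ℝ) : ℝ≥0∞ :=
  ∑' m : ℕ, (r2 m : ℝ≥0∞) * volume ({t : ℝ | G ≤ |(m : ℝ) - t| ∧ |(m : ℝ) - t| < s} ∩ Ioc T (2 * T))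

lemma tauq_eq_toReal (q t G : ℝ) : tauq q t G =
    (∑' m : ℕ, (r2 m : ℝ≥0∞) * {m : ℕ | G ≤ |(m : ℝ) - t|}.indicator
      (fun m => ENNReal.ofReal (|(m : ℝ) - t| ^ (-(2 * q)))) m).toReal := by
  rw [ENNReal.tsum_toReal_eq, tauq]
  · refine (tsum_subtype {m : ℕ | G ≤ |(m : ℝ) - t|}
      (fun m : ℕ => (r2 m : ℝ) * |(m : ℝ) - t| ^ (-(2 * q)))).trans (tsum_congr fun m => ?_)
    by_cases h : m ∈ {m : ℕ | G ≤ |(m : ℝ) - t|}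
    · simp [Set.indicator_of_mem h, ENNReal.toReal_ofReal, Real.rpow_nonneg]
    · simp [Set.indicator_of_notMem h]
  · intro m
    refine ENNReal.mul_ne_top (by simp) ?_
    by_cases h : m ∈ {m : ℕ | G ≤ |(m : ℝ) - t|}
    · simp [Set.indicator_of_mem h]
    · simp [Set.indicator_of_notMem h]

lemma lintegral_Ioi_rpow {a c : ℝ} (ha : a < -1) (hc : 0 < c) :
    ∫⁻ v in Ioi c, ENNReal.ofReal (v ^ a) = ENNReal.ofReal (-c ^ (a + 1) / (a + 1)) := by
  rw [← integral_Ioi_rpow_of_lt ha hc, ofReal_integral_eq_lintegral_ofReal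
    (integrableOn_Ioi_rpow_of_lt ha hc)]
  filter_upwards [ae_restrict_mem measurableSet_Ioi] with v hv
  exact Real.rpow_nonneg (hc.trans hv).le _

lemma ofReal_rpow_eq_lintegral {q : ℝ} (hq : 1 / 2 < q) {w : ℝ} (hw : 0 < w) :
    ENNReal.ofReal (w ^ (-(2 * q))) =
      ∫⁻ v in Ioi w, ENNReal.ofReal (2 * q * v ^ (-(2 * q) - 1)) := by
  simp_rw [ENNReal.ofReal_mul (by linarith : 0 ≤ 2 * q)]
  rw [lintegral_const_mul _ (by fun_prop), lintegral_Ioi_rpow (by linarith) hw,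
    ← ENNReal.ofReal_mul (by linarith)]
  congr 1
  have : q ≠ 0 := by linarith
  rw [sub_add_cancel]
  field_simp

lemma indicator_rpow_eq_lintegral {q : ℝ} (hq : 1 / 2 < q) {G : ℝ} (hG : 0 < G) (m : ℕ) (t : ℝ) :
    {m : ℕ | G ≤ |(m : ℝ) - t|}.indicator
      (fun m => ENNReal.ofReal (|(m : ℝ) - t| ^ (-(2 * q)))) m =
    ENNReal.ofReal (G ^ (-(2 * q))) * ∫⁻ v in Ioi (1 : ℝ),
      ENNReal.ofReal (2 * q * v ^ (-(2 * q) - 1)) *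
        {t : ℝ | G ≤ |(m : ℝ) - t| ∧ |(m : ℝ) - t| < G * v}.indicator 1 t := by
  by_cases h : G ≤ |(m : ℝ) - t|
  · have hw : 0 < |(m : ℝ) - t| / G := div_pos (hG.trans_le h) hG
    have hw1 : 1 ≤ |(m : ℝ) - t| / G := (one_le_div hG).2 h
    rw [Set.indicator_of_mem (by exact h)]
    have e : |(m : ℝ) - t| ^ (-(2 * q)) = G ^ (-(2 * q)) * (|(m : ℝ) - t| / G) ^ (-(2 * q)) := by
      rw [← Real.mul_rpow hG.le hw.le, mul_div_cancel₀ _ hG.ne']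
    rw [e, ENNReal.ofReal_mul (by positivity), ofReal_rpow_eq_lintegral hq hw,
      ← lintegral_indicator measurableSet_Ioi, ← lintegral_indicator measurableSet_Ioi]
    congr 2
    ext v
    have hiff : |(m : ℝ) - t| < G * v ↔ v ∈ Ioi (|(m : ℝ) - t| / G) := by
      rw [mem_Ioi, div_lt_iff₀' hG]
    by_cases hv : v ∈ Ioi (|(m : ℝ) - t| / G)
    · have hv1 : v ∈ Ioi (1 : ℝ) := hw1.trans_lt hv
      rw [Set.indicator_of_mem hv, Set.indicator_of_mem hv1,
        Set.indicator_of_mem (show t ∈ {t : ℝ | G ≤ |(m : ℝ) - t| ∧ |(m : ℝ) - t| < G * v} from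
          ⟨h, hiff.2 hv⟩)]
      simp
    · have ht : t ∉ {t : ℝ | G ≤ |(m : ℝ) - t| ∧ |(m : ℝ) - t| < G * v} :=
        fun h => hv (hiff.1 h.2)
      rw [Set.indicator_of_notMem hv, eq_comm, Set.indicator_apply_eq_zero]
      intro _
      rw [Set.indicator_of_notMem ht, mul_zero]
  · rw [Set.indicator_of_notMem (by exact h)]
    simp [Set.indicator, h]

lemma measurableSet_shell (G : ℝ) (m : ℕ) :
    MeasurableSet {p : ℝ × ℝ | G ≤ |(m : ℝ) - p.1| ∧ |(m : ℝ) - p.1| < G * p.2} := by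
  have h1 : MeasurableSet {p : ℝ × ℝ | G ≤ |(m : ℝ) - p.1|} :=
    measurableSet_le (by fun_prop) (by fun_prop)
  have h2 : MeasurableSet {p : ℝ × ℝ | |(m : ℝ) - p.1| < G * p.2} :=
    measurableSet_lt (by fun_prop) (by fun_prop)
  exact h1.inter h2

lemma measurable_indicator_rpow (q G : ℝ) (m : ℕ) :
    Measurable fun t : ℝ => {m : ℕ | G ≤ |(m : ℝ) - t|}.indicator
      (fun m => ENNReal.ofReal (|(m : ℝ) - t| ^ (-(2 * q)))) m := by
  have hs : MeasurableSet {t : ℝ | G ≤ |(m : ℝ) - t|} :=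
    measurableSet_le (by fun_prop) (by fun_prop)
  have : Measurable fun t : ℝ => ENNReal.ofReal (|(m : ℝ) - t| ^ (-(2 * q))) := by fun_prop
  exact this.indicator hs

lemma measurable_shellMass (G T : ℝ) : Measurable (shellMass G T) := by
  refine Monotone.measurable fun s s' hs => ENNReal.tsum_le_tsum fun m => ?_
  gcongr

lemma lintegral_tail {q : ℝ} (hq : 1 / 2 < q) {G : ℝ} (hG : 0 < G) (T : ℝ) :
    ∫⁻ t in Ioc T (2 * T), ∑' m : ℕ, (r2 m : ℝ≥0∞) * {m : ℕ | G ≤ |(m : ℝ) - t|}.indicator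
      (fun m => ENNReal.ofReal (|(m : ℝ) - t| ^ (-(2 * q)))) m =
    ENNReal.ofReal (G ^ (-(2 * q))) * ∫⁻ v in Ioi (1 : ℝ),
      ENNReal.ofReal (2 * q * v ^ (-(2 * q) - 1)) * shellMass G T (G * v) := by
  have hk : Measurable fun v : ℝ => ENNReal.ofReal (2 * q * v ^ (-(2 * q) - 1)) := by fun_prop
  rw [lintegral_tsum fun m => ((measurable_indicator_rpow q G m).const_mul _).aemeasurable]
  simp_rw [shellMass, ← ENNReal.tsum_mul_left]
  rw [lintegral_tsum, ← ENNReal.tsum_mul_left]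
  · refine tsum_congr fun m => ?_
    have hS := measurableSet_shell G m
    have hmeas : Measurable (Function.uncurry fun t v : ℝ =>
        ENNReal.ofReal (2 * q * v ^ (-(2 * q) - 1)) *
        {t : ℝ | G ≤ |(m : ℝ) - t| ∧ |(m : ℝ) - t| < G * v}.indicator (1 : ℝ → ℝ≥0∞) t) :=
      (hk.comp measurable_snd).mul (measurable_one.indicator hS)
    simp_rw [indicator_rpow_eq_lintegral hq hG m]
    rw [lintegral_const_mul _ (by
      exact (hmeas.lintegral_prod_right).const_mul _), lintegral_const_mul _ (by
      exact hmeas.lintegral_prod_right), lintegral_lintegral_swap hmeas.aemeasurable,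
      mul_left_comm]
    congr 1
    rw [← lintegral_const_mul _ (by exact hmeas.lintegral_prod_left)]
    refine lintegral_congr fun v => ?_
    have hv : MeasurableSet {t : ℝ | G ≤ |(m : ℝ) - t| ∧ |(m : ℝ) - t| < G * v} :=
      measurable_prodMk_right hS
    rw [lintegral_const_mul _ (measurable_one.indicator hv), lintegral_indicator_one hv,
      Measure.restrict_apply hv, mul_left_comm]
  · intro m
    refine (hk.mul (Measurable.const_mul ?_ _)).aemeasurable
    refine Monotone.measurable fun s s' hs => ?_
    refine measure_mono (inter_subset_inter_left _ fun t ht => ⟨ht.1, ht.2.trans_le ?_⟩)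
    gcongr

lemma volume_shell {G s : ℝ} (hG : 0 < G) (hs : G ≤ s) (m : ℕ) :
    volume {t : ℝ | G ≤ |(m : ℝ) - t| ∧ |(m : ℝ) - t| < s} = ENNReal.ofReal (2 * (s - G)) := by
  have h : {t : ℝ | G ≤ |(m : ℝ) - t| ∧ |(m : ℝ) - t| < s} =
      Ioc ((m : ℝ) - s) (m - G) ∪ Ico ((m : ℝ) + G) (m + s) := by
    ext t
    simp only [Set.mem_ofPred_eq, mem_union, mem_Ioc, mem_Ico, le_abs, abs_lt]
    constructor
    · rintro ⟨h | h, h1, h2⟩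
      · exact Or.inl ⟨by linarith, by linarith⟩
      · exact Or.inr ⟨by linarith, by linarith⟩
    · rintro (⟨h1, h2⟩ | ⟨h1, h2⟩)
      · exact ⟨Or.inl (by linarith), by linarith, by linarith⟩
      · exact ⟨Or.inr (by linarith), by linarith, by linarith⟩
  rw [h, measure_union _ measurableSet_Ico, Real.volume_Ioc, Real.volume_Ico,
    ← ENNReal.ofReal_add (by linarith) (by linarith)]
  · congr 1; ring
  · rw [Set.disjoint_left]
    rintro t ⟨-, h1⟩ ⟨h2, -⟩
    linarith

lemma ofReal_r2Sum_sub {x y : ℝ} (hxy : x ≤ y) : ENNReal.ofReal (r2Sum y - r2Sum x) =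
    ∑ m ∈ Finset.Ico (⌊x⌋₊ + 1) (⌊y⌋₊ + 1), (r2 m : ℝ≥0∞) := by
  rw [r2Sum, r2Sum, ← Finset.sum_Ico_eq_sub _ (by gcongr), ENNReal.ofReal_sum_of_nonneg (by simp)]
  simp

lemma ofReal_r2Sum (x : ℝ) : ENNReal.ofReal (r2Sum x) =
    ∑ m ∈ Finset.range (⌊x⌋₊ + 1), (r2 m : ℝ≥0∞) := by
  rw [r2Sum, ENNReal.ofReal_sum_of_nonneg (by simp)]
  simp

lemma tsum_r2_mul_le {w : ℕ → ℝ≥0∞} {c : ℝ≥0∞} (S : Finset ℕ) (hw : ∀ m, w m ≤ c)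
    (hS : ∀ m ∉ S, w m = 0) :
    ∑' m, (r2 m : ℝ≥0∞) * w m ≤ c * ∑ m ∈ S, (r2 m : ℝ≥0∞) := by
  rw [tsum_eq_sum (s := S) fun m hm => by rw [hS m hm, mul_zero], mul_comm, Finset.sum_mul]
  gcongr with m
  exact hw m

lemma shellMass_le {G T s : ℝ} (hG : 0 < G) (hs : G ≤ s) (hT : s ≤ T) :
    shellMass G T s ≤ ENNReal.ofReal (2 * (s - G) * (r2Sum (2 * T + s) - r2Sum (T - s))) := by
  rw [ENNReal.ofReal_mul (by linarith), ofReal_r2Sum_sub (by linarith)]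
  refine tsum_r2_mul_le _ (fun m => ?_) fun m hm => ?_
  · rw [← volume_shell hG hs m]
    exact measure_mono inter_subset_left
  · convert! measure_empty (μ := volume)
    rw [Set.eq_empty_iff_forall_notMem]
    rintro t ⟨⟨-, h⟩, h1, h2⟩
    rw [abs_lt] at h
    apply hm
    rw [Finset.mem_Ico, Nat.succ_le_iff, Nat.floor_lt (by linarith), Nat.lt_succ_iff,
      Nat.le_floor_iff (by linarith)]
    constructor <;> linarith

lemma le_shellMass {G T s : ℝ} (hG : 0 < G) (hs : G ≤ s) (hT : 2 * s ≤ T) :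
    ENNReal.ofReal (2 * (s - G) * (r2Sum (2 * T - s) - r2Sum (T + s))) ≤ shellMass G T s := by
  rw [ENNReal.ofReal_mul (by linarith), ofReal_r2Sum_sub (by linarith), mul_comm, Finset.sum_mul]
  refine le_trans (Finset.sum_le_sum fun m hm => ?_) (ENNReal.sum_le_tsum _)
  rw [Finset.mem_Ico, Nat.succ_le_iff, Nat.floor_lt (by linarith), Nat.lt_succ_iff,
      Nat.le_floor_iff (by linarith)] at hm
  rw [← volume_shell hG hs m]
  gcongr
  refine subset_inter subset_rfl ?_
  rintro t ⟨-, h⟩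
  rw [abs_lt] at h
  constructor <;> linarith

lemma shellMass_le_of_r2Sum_le {G T s C : ℝ} (hG : 0 < G) (hs : G ≤ s) (hT : 0 < T) (hC : 0 ≤ C)
    (h : r2Sum (2 * T + s) ≤ C * (2 * T + s)) :
    shellMass G T s ≤ ENNReal.ofReal (6 * C * (s * T)) := by
  have hsum : shellMass G T s ≤ ENNReal.ofReal (min (2 * s) T * r2Sum (2 * T + s)) := by
    have hmin : 0 ≤ min (2 * s) T := le_min (by linarith) hT.le
    rw [ENNReal.ofReal_mul hmin, ofReal_r2Sum]
    refine tsum_r2_mul_le _ (fun m => ?_) fun m hm => ?_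
    · rw [ENNReal.ofReal_min]
      refine le_min ?_ ?_
      · refine (measure_mono inter_subset_left).trans ?_
        rw [volume_shell hG hs m]
        exact ENNReal.ofReal_le_ofReal (by linarith)
      · refine (measure_mono inter_subset_right).trans ?_
        rw [Real.volume_Ioc]
        exact ENNReal.ofReal_le_ofReal (by linarith)
    · convert! measure_empty (μ := volume)
      rw [Set.eq_empty_iff_forall_notMem]
      rintro t ⟨⟨-, h⟩, h1, h2⟩
      rw [abs_lt] at h
      apply hm
      rw [Finset.mem_range, Nat.lt_succ_iff, Nat.le_floor_iff (by linarith)]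
      linarith
  refine hsum.trans (ENNReal.ofReal_le_ofReal ?_)
  have hs0 : 0 < s := hG.trans_le hs
  rcases le_total s T with hsT | hsT
  · calc min (2 * s) T * r2Sum (2 * T + s) ≤ (2 * s) * (C * (3 * T)) := by
          refine mul_le_mul (min_le_left _ _) (h.trans ?_) (Finset.sum_nonneg (by simp)) (by linarith)
          gcongr; linarith
      _ = _ := by ring
  · calc min (2 * s) T * r2Sum (2 * T + s) ≤ T * (C * (3 * s)) := by
          refine mul_le_mul (min_le_right _ _) (h.trans ?_) (Finset.sum_nonneg (by simp)) hT.le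
          gcongr; linarith
      _ ≤ _ := by nlinarith [mul_nonneg hC (mul_pos hs0 hT).le]

lemma tendsto_r2Sum_comp_div {x : ℝ → ℝ} {a : ℝ} (ha : 0 < a)
    (hx : Tendsto (fun T => x T / T) atTop (𝓝 a)) :
    Tendsto (fun T => r2Sum (x T) / T) atTop (𝓝 (Real.pi * a)) := by
  have hxt : Tendsto x atTop atTop := by
    refine (hx.pos_mul_atTop ha tendsto_id).congr' ?_
    filter_upwards [eventually_gt_atTop 0] with T hT
    simp [hT.ne']
  refine ((tendsto_r2Sum_div.comp hxt).mul hx).congr' ?_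
  filter_upwards [hxt.eventually_gt_atTop 0] with T hT
  simp only [Function.comp]
  field_simp

lemma tendsto_shellMass {G : ℝ → ℝ} (hGpos : ∀ T : ℝ, 0 < G T)
    (hG : Tendsto (fun T : ℝ => G T / T) atTop (𝓝 0)) {v : ℝ} (hv : 1 ≤ v) :
    Tendsto (fun T => ENNReal.ofReal (1 / (G T * T)) * shellMass (G T) T (G T * v)) atTop
      (𝓝 (ENNReal.ofReal (2 * Real.pi * (v - 1)))) := by
  have hGv : Tendsto (fun T : ℝ => G T * v / T) atTop (𝓝 0) := by
    simpa [mul_div_right_comm] using hG.mul_const v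
  have hlin (a b : ℝ) : Tendsto (fun T : ℝ => (a * T + b * (G T * v)) / T) atTop (𝓝 a) := by
    have := (hGv.const_mul b).const_add a
    rw [mul_zero, add_zero] at this
    refine this.congr' ?_
    filter_upwards [eventually_gt_atTop 0] with T hT
    field_simp
  have hlim (b : ℝ) : Tendsto (fun T : ℝ => ENNReal.ofReal (2 * (v - 1) *
      (r2Sum (2 * T + b * (G T * v)) / T - r2Sum (1 * T + -b * (G T * v)) / T))) atTop
      (𝓝 (ENNReal.ofReal (2 * Real.pi * (v - 1)))) := by
    refine ENNReal.tendsto_ofReal ?_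
    convert! ((tendsto_r2Sum_comp_div two_pos (hlin 2 b)).sub
      (tendsto_r2Sum_comp_div one_pos (hlin 1 (-b)))).const_mul (2 * (v - 1)) using 2
    ring
  have hsmall : ∀ᶠ T in atTop, 0 < T ∧ 2 * (G T * v) ≤ T := by
    filter_upwards [eventually_gt_atTop 0,
      hGv.eventually_le_const (by norm_num : (0 : ℝ) < 1 / 2)] with T hT h
    rw [div_le_iff₀ hT] at h
    exact ⟨hT, by linarith⟩
  refine tendsto_of_tendsto_of_tendsto_of_le_of_le' (hlim (-1)) (hlim 1) ?_ ?_
  · filter_upwards [hsmall] with T ⟨hT, h⟩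
    have hGT := hGpos T
    have hs : G T ≤ G T * v := le_mul_of_one_le_right hGT.le hv
    refine le_trans (le_of_eq ?_) (mul_le_mul_right (le_shellMass hGT hs h) _)
    rw [← ENNReal.ofReal_mul (by positivity)]
    congr 1
    simp only [neg_mul, neg_neg, one_mul, ← sub_eq_add_neg]
    field_simp
  · filter_upwards [hsmall] with T ⟨hT, h⟩
    have hGT := hGpos T
    have hs : G T ≤ G T * v := le_mul_of_one_le_right hGT.le hv
    refine le_trans (mul_le_mul_right (shellMass_le hGT hs (by linarith)) _) (le_of_eq ?_)
    rw [← ENNReal.ofReal_mul (by positivity)]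
    congr 1
    simp only [neg_mul, one_mul, ← sub_eq_add_neg]
    field_simp

lemma lintegral_kernel_mul_sub_one {q : ℝ} (hq : 1 / 2 < q) :
    ∫⁻ v in Ioi (1 : ℝ), ENNReal.ofReal (2 * q * v ^ (-(2 * q) - 1)) *
      ENNReal.ofReal (2 * Real.pi * (v - 1)) = ENNReal.ofReal (2 * Real.pi / (2 * q - 1)) := by
  have h1 : IntegrableOn (fun v : ℝ => v ^ (-(2 * q))) (Ioi 1) :=
    integrableOn_Ioi_rpow_of_lt (by linarith) one_pos
  have h2 : IntegrableOn (fun v : ℝ => v ^ (-(2 * q) - 1)) (Ioi 1) :=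
    integrableOn_Ioi_rpow_of_lt (by linarith) one_pos
  have hval : ∫ v in Ioi (1 : ℝ), 4 * q * Real.pi * (v ^ (-(2 * q)) - v ^ (-(2 * q) - 1)) =
      2 * Real.pi / (2 * q - 1) := by
    rw [integral_const_mul, integral_sub h1 h2, integral_Ioi_rpow_of_lt (by linarith) one_pos,
      integral_Ioi_rpow_of_lt (by linarith) one_pos, Real.one_rpow, Real.one_rpow]
    have hq1 : 2 * q - 1 ≠ 0 := by linarith
    have hq0 : q ≠ 0 := by linarith
    rw [show -(2 * q) - 1 + 1 = -(2 * q) by ring, show -(2 * q) + 1 = -(2 * q - 1) by ring,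
      neg_div_neg_eq, neg_div_neg_eq, div_sub_div _ _ hq1 (by positivity)]
    field_simp
    ring
  have hint : IntegrableOn (fun v : ℝ =>
      4 * q * Real.pi * (v ^ (-(2 * q)) - v ^ (-(2 * q) - 1))) (Ioi 1) :=
    (h1.sub h2).const_mul _
  rw [← hval, ofReal_integral_eq_lintegral_ofReal hint]
  · refine setLIntegral_congr_fun measurableSet_Ioi fun v hv => ?_
    have hv0 : (0 : ℝ) < v := one_pos.trans hv
    rw [← ENNReal.ofReal_mul (by have := Real.rpow_nonneg hv0.le (-(2 * q) - 1); positivity)]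
    congr 1
    rw [Real.rpow_sub_one hv0.ne']
    field_simp
    ring
  · filter_upwards [ae_restrict_mem measurableSet_Ioi] with v hv
    have : v ^ (-(2 * q) - 1) ≤ v ^ (-(2 * q)) :=
      Real.rpow_le_rpow_of_exponent_le (le_of_lt hv) (by linarith)
    have := Real.pi_pos
    exact mul_nonneg (by positivity) (by linarith)

lemma lintegral_kernel_mul_ne_top {q : ℝ} (hq : 1 / 2 < q) {C : ℝ} (hC : 0 ≤ C) :
    ∫⁻ v in Ioi (1 : ℝ), ENNReal.ofReal (2 * q * v ^ (-(2 * q) - 1)) *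
      ENNReal.ofReal (C * v) ≠ ∞ := by
  have h : ∫⁻ v in Ioi (1 : ℝ), ENNReal.ofReal (2 * q * v ^ (-(2 * q) - 1)) *
      ENNReal.ofReal (C * v) =
      ∫⁻ v in Ioi (1 : ℝ), ENNReal.ofReal (2 * q * C) * ENNReal.ofReal (v ^ (-(2 * q))) := by
    refine setLIntegral_congr_fun measurableSet_Ioi fun v hv => ?_
    have hv0 : (0 : ℝ) < v := one_pos.trans hv
    rw [← ENNReal.ofReal_mul (by have := Real.rpow_nonneg hv0.le (-(2 * q) - 1); positivity),
      ← ENNReal.ofReal_mul (by positivity)]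
    congr 1
    rw [Real.rpow_sub_one hv0.ne']
    field_simp
  rw [h, lintegral_const_mul _ (by fun_prop), lintegral_Ioi_rpow (by linarith) one_pos]
  exact ENNReal.mul_ne_top ENNReal.ofReal_ne_top ENNReal.ofReal_ne_top

lemma tendsto_lintegral_shellMass {q : ℝ} (hq : 1 / 2 < q) {G : ℝ → ℝ} (hGpos : ∀ T : ℝ, 0 < G T)
    (hG : Tendsto (fun T : ℝ => G T / T) atTop (𝓝 0)) :
    Tendsto (fun T => ∫⁻ v in Ioi (1 : ℝ), ENNReal.ofReal (2 * q * v ^ (-(2 * q) - 1)) *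
      (ENNReal.ofReal (1 / (G T * T)) * shellMass (G T) T (G T * v))) atTop
      (𝓝 (ENNReal.ofReal (2 * Real.pi / (2 * q - 1)))) := by
  rw [← lintegral_kernel_mul_sub_one hq]
  refine tendsto_lintegral_filter_of_dominated_convergence (fun v =>
    ENNReal.ofReal (2 * q * v ^ (-(2 * q) - 1)) * ENNReal.ofReal (24 * v))
    (Eventually.of_forall fun T => ?_) ?_ (lintegral_kernel_mul_ne_top hq (by norm_num)) ?_
  · have := measurable_shellMass (G T) T
    fun_prop
  · obtain ⟨X, hX⟩ := eventually_atTop.1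
      (tendsto_r2Sum_div.eventually_le_const Real.pi_lt_four)
    filter_upwards [eventually_ge_atTop X, eventually_gt_atTop 0] with T hTX hT
    filter_upwards [ae_restrict_mem measurableSet_Ioi] with v hv
    have hGT := hGpos T
    have hv1 : 1 ≤ v := le_of_lt hv
    have hs : G T ≤ G T * v := le_mul_of_one_le_right hGT.le hv1
    have hle := hX (2 * T + G T * v) (by linarith)
    rw [div_le_iff₀ (by linarith)] at hle
    gcongr
    refine (mul_le_mul_right (shellMass_le_of_r2Sum_le hGT hs hT (by norm_num) hle) _).trans
      (le_of_eq ?_)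
    rw [← ENNReal.ofReal_mul (by positivity)]
    congr 1
    field_simp
    norm_num
  · filter_upwards [ae_restrict_mem measurableSet_Ioi] with v hv
    exact ENNReal.Tendsto.const_mul (tendsto_shellMass hGpos hG (le_of_lt hv))
      (Or.inr ENNReal.ofReal_ne_top)

/-- The mean tail satisfies `⟨τ_q⟩_T ∼ (2π/(2q−1)) G^{1−2q}` as `T → ∞`. -/
theorem mean_tail_asymptotic (q : ℝ) (hq : 1 / 2 < q)
    (G : ℝ → ℝ) (hGpos : ∀ T : ℝ, 0 < G T)
    (hG1 : Tendsto G atTop atTop)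
    (hG2 : Tendsto (fun T : ℝ => G T / T) atTop (𝓝 0)) :
    Tendsto (fun T : ℝ => G T ^ (2 * q - 1) * ((1 / T) * ∫ t in T..(2 * T), tauq q t (G T)))
      atTop (𝓝 (2 * Real.pi / (2 * q - 1))) := by
  have hlim := tendsto_lintegral_shellMass hq hGpos hG2
  have hreal := (ENNReal.tendsto_toReal ENNReal.ofReal_ne_top).comp hlim
  rw [ENNReal.toReal_ofReal (div_nonneg (by positivity) (by linarith))] at hreal
  refine hreal.congr' ?_
  filter_upwards [eventually_gt_atTop 0, hlim.eventually_lt_const ENNReal.ofReal_lt_top]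
    with T hT hfin
  have hGT := hGpos T
  have hpull : ∫⁻ v in Ioi (1 : ℝ), ENNReal.ofReal (2 * q * v ^ (-(2 * q) - 1)) *
      (ENNReal.ofReal (1 / (G T * T)) * shellMass (G T) T (G T * v)) =
      ENNReal.ofReal (1 / (G T * T)) * ∫⁻ v in Ioi (1 : ℝ),
        ENNReal.ofReal (2 * q * v ^ (-(2 * q) - 1)) * shellMass (G T) T (G T * v) := by
    have := measurable_shellMass (G T) T
    rw [← lintegral_const_mul _ (by fun_prop)]
    exact lintegral_congr fun v => mul_left_comm _ _ _
  rw [hpull] at hfin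
  have hne : ∫⁻ v in Ioi (1 : ℝ),
      ENNReal.ofReal (2 * q * v ^ (-(2 * q) - 1)) * shellMass (G T) T (G T * v) ≠ ∞ := by
    intro h
    rw [h, ENNReal.mul_top (ENNReal.ofReal_pos.2 (by positivity)).ne'] at hfin
    exact hfin.ne rfl
  have hmeas : Measurable fun t : ℝ => ∑' m : ℕ, (r2 m : ℝ≥0∞) *
      {m : ℕ | G T ≤ |(m : ℝ) - t|}.indicator
        (fun m => ENNReal.ofReal (|(m : ℝ) - t| ^ (-(2 * q)))) m :=
    Measurable.tsum fun m => (measurable_indicator_rpow q (G T) m).const_mul _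
  have htail := lintegral_tail hq hGT T
  simp_rw [tauq_eq_toReal]
  rw [intervalIntegral.integral_of_le (by linarith), integral_toReal hmeas.aemeasurable
    (ae_lt_top hmeas (by rw [htail]; exact ENNReal.mul_ne_top ENNReal.ofReal_ne_top hne)), htail]
  simp only [Function.comp]
  rw [hpull, ENNReal.toReal_mul, ENNReal.toReal_mul, ENNReal.toReal_ofReal (by positivity),
    ENNReal.toReal_ofReal (by positivity)]
  have hpow : G T ^ (2 * q - 1) * G T ^ (-(2 * q)) = 1 / G T := by
    rw [← Real.rpow_add hGT, show 2 * q - 1 + -(2 * q) = -1 by ring, Real.rpow_neg_one, one_div]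
  rw [show ∀ a b c d : ℝ, a * (b * (c * d)) = (a * c) * b * d by intros; ring, hpow]
  field_simp
end
end
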